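/- arXiv:1510.04145 — 3 statements merged into one kernel-verified Lean document; each statement's English description precedes it below -/
import Mathlib

section
/- Let A, g be positive integers, χ a Dirichlet character modulo g, α a real number, and q ≥ 1 an integer such that ‖qα‖ ≤ 1/q (i.e., α admits a rational approximation a/q with gcd(a,q)=1 and |α − a/q| ≤ 1/q²). Then there is a constant C (depending only on A and g) such that for all x ≥ 2, |∑_{n ≤ x} χ(n)Λ(n)e(αAn)| ≤ C·(x^{4/5} + x·q^{−1/2} + x^{1/2}·q^{1/2})·(log x)³, where Λ is the von Mangoldt function and e(θ) = e^{2πiθ}. -/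
/-- The additive character `t ↦ e(t) = exp(2πit)` of the real line. -/
noncomputable def expChar (t : ℝ) : ℂ := Complex.exp (2 * Real.pi * Complex.I * t)

lemma expChar_add (s t : ℝ) : expChar (s + t) = expChar s * expChar t := by
  simp only [expChar, ← Complex.exp_add]
  push_cast
  ring_nf

lemma expChar_intCast (z : ℤ) : expChar z = 1 := by
  rw [expChar, Complex.exp_eq_one_iff]
  exact ⟨z, by push_cast; ring⟩

lemma expChar_eq_exp_I_mul (t : ℝ) :
    expChar t = Complex.exp (Complex.I * ((2 * Real.pi * t : ℝ) : ℂ)) := by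
  rw [expChar]
  push_cast
  ring_nf

lemma norm_expChar (t : ℝ) : ‖expChar t‖ = 1 := by
  rw [expChar_eq_exp_I_mul, Complex.norm_exp_I_mul_ofReal]

lemma conj_expChar (t : ℝ) : (starRingEnd ℂ) (expChar t) = expChar (-t) := by
  rw [expChar_eq_exp_I_mul, expChar_eq_exp_I_mul, ← Complex.exp_conj, map_mul, Complex.conj_I,
    Complex.conj_ofReal]
  push_cast
  ring_nf

/-- `|e(t) - 1|` dominates four times the distance from `t` to the nearest integer. -/
lemma four_mul_abs_sub_round_le (t : ℝ) : 4 * |t - round t| ≤ ‖expChar t - 1‖ := by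
  have hsplit : expChar t = expChar (t - round t) := by
    conv_lhs => rw [show t = (t - round t) + ((round t : ℤ) : ℝ) by ring]
    rw [expChar_add, expChar_intCast, mul_one]
  have hround := abs_sub_round t
  rw [hsplit, expChar_eq_exp_I_mul, Complex.norm_exp_I_mul_ofReal_sub_one]
  set u := t - round t
  have hπ := Real.pi_pos
  have habs : |Real.pi * u| = Real.pi * |u| := by rw [abs_mul, abs_of_pos hπ]
  have hsin := Real.mul_abs_le_abs_sin (x := Real.pi * u) (by rw [habs]; nlinarith)
  rw [habs, ← mul_assoc, div_mul_cancel₀ _ hπ.ne'] at hsin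
  rw [show 2 * Real.pi * u / 2 = Real.pi * u by ring, norm_mul]
  simp only [Real.norm_eq_abs, abs_two]
  linarith

/-- Sums over intervals of a sequence with `u (n + g) = z * u n` exhibit geometric cancellation. -/
lemma norm_sub_one_mul_norm_sum_Ico_le {u : ℕ → ℂ} {z : ℂ} {g : ℕ}
    (hu : ∀ n, ‖u n‖ ≤ 1) (hz : ∀ n, u (n + g) = z * u n) (a b : ℕ) :
    ‖z - 1‖ * ‖∑ n ∈ Finset.Ico a b, u n‖ ≤ 2 * g := by
  rcases le_total b a with hab | hab
  · simp [Finset.Ico_eq_empty_of_le hab]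
  have hshort : ∀ c, ‖∑ n ∈ Finset.Ico c (c + g), u n‖ ≤ g := fun c => by
    simpa using norm_sum_le_of_le (Finset.Ico c (c + g)) (fun n _ => hu n)
  have hshift : z * ∑ n ∈ Finset.Ico a b, u n = ∑ n ∈ Finset.Ico (a + g) (b + g), u n := by
    rw [Finset.mul_sum, ← Finset.sum_Ico_add']
    exact Finset.sum_congr rfl fun n _ => (hz n).symm
  have hleft := Finset.sum_Ico_consecutive u hab (Nat.le_add_right b g)
  have hright := Finset.sum_Ico_consecutive u (Nat.le_add_right a g) (Nat.add_le_add_right hab g)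
  have htel : (z - 1) * ∑ n ∈ Finset.Ico a b, u n
      = ∑ n ∈ Finset.Ico b (b + g), u n - ∑ n ∈ Finset.Ico a (a + g), u n := by
    rw [sub_mul, one_mul, hshift]
    linear_combination hright - hleft
  rw [← norm_mul, htel]
  calc _ ≤ _ := norm_sub_le _ _
    _ ≤ g + g := add_le_add (hshort b) (hshort a)
    _ = _ := by ring

/-- Abel summation with logarithmic weights. -/
lemma norm_sum_log_mul_le {u : ℕ → ℂ} {S : ℝ} {K : ℕ} (hK : 1 ≤ K)
    (hS : ∀ k ≤ K, ‖∑ n ∈ Finset.Ico 1 (k + 1), u n‖ ≤ S) :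
    ‖∑ n ∈ Finset.Ico 1 (K + 1), (Real.log n : ℂ) * u n‖ ≤ 2 * Real.log K * S := by
  have hlogmono : ∀ k : ℕ, 1 ≤ k → Real.log k ≤ Real.log (k + 1 : ℕ) := fun k hk =>
    Real.log_le_log (by exact_mod_cast hk) (by push_cast; linarith)
  have habel : ∀ k : ℕ, 1 ≤ k → ∑ n ∈ Finset.Ico 1 (k + 1), (Real.log n : ℂ) * u n
      = (Real.log k : ℂ) * ∑ n ∈ Finset.Ico 1 (k + 1), u n
        - ∑ j ∈ Finset.Ico 1 k, ((Real.log (j + 1 : ℕ) - Real.log j : ℝ) : ℂ)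
            * ∑ n ∈ Finset.Ico 1 (j + 1), u n := by
    intro k hk
    induction k, hk using Nat.le_induction with
    | base => simp
    | succ k hk ih =>
      have hw := Finset.sum_Ico_succ_top (show 1 ≤ k + 1 by lia)
        (fun n => (Real.log n : ℂ) * u n)
      have hv := Finset.sum_Ico_succ_top (show 1 ≤ k + 1 by lia) u
      have hd := Finset.sum_Ico_succ_top hk
        (fun j => ((Real.log (j + 1 : ℕ) - Real.log j : ℝ) : ℂ)
            * ∑ n ∈ Finset.Ico 1 (j + 1), u n)
      rw [hw, ih, hv, hd, Complex.ofReal_sub]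
      ring
  have htel : ∀ k : ℕ, 1 ≤ k →
      ∑ j ∈ Finset.Ico 1 k, (Real.log (j + 1 : ℕ) - Real.log j) = Real.log k := by
    intro k hk
    rw [Finset.sum_Ico_sub (fun j : ℕ => Real.log j) hk]
    simp
  rw [habel K hK]
  calc _ ≤ _ := norm_sub_le _ _
    _ ≤ Real.log K * S + ∑ j ∈ Finset.Ico 1 K, (Real.log (j + 1 : ℕ) - Real.log j) * S := by
      have hlog : 0 ≤ Real.log K := Real.log_natCast_nonneg K
      refine add_le_add ?_ (norm_sum_le_of_le _ fun j hj => ?_)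
      · rw [norm_mul, Complex.norm_real, Real.norm_of_nonneg hlog]
        exact mul_le_mul_of_nonneg_left (hS K le_rfl) hlog
      · have hj' := Finset.mem_Ico.mp hj
        have hnonneg := sub_nonneg.mpr (hlogmono j hj'.1)
        rw [norm_mul, Complex.norm_real, Real.norm_of_nonneg hnonneg]
        exact mul_le_mul_of_nonneg_left (hS j hj'.2.le) hnonneg
    _ = _ := by rw [← Finset.sum_mul, htel K hK]; ring

/-- A real number with a reduced approximation `a / q` of quality `1 / q ^ 2` keeps its small
nonzero multiples away from the integers. -/
lemma one_div_two_mul_le_abs_mul_sub {α : ℝ} {a : ℤ} {q : ℕ} (hq : 1 ≤ q)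
    (hgcd : Int.gcd a q = 1) (hα : |α - (a : ℝ) / q| ≤ 1 / (q : ℝ) ^ 2)
    {k : ℤ} (hk0 : k ≠ 0) (hk : 2 * |k| ≤ q) (z : ℤ) :
    1 / (2 * (q : ℝ)) ≤ |α * k - z| := by
  have hqpos : (0 : ℝ) < q := by exact_mod_cast hq
  have hne : a * k - z * q ≠ 0 := by
    intro h
    have hdvd : (q : ℤ) ∣ a * k := ⟨z, by linarith⟩
    have hdvd' : (q : ℤ) ∣ k :=
      Int.dvd_of_dvd_mul_right_of_gcd_one hdvd (by rwa [Int.gcd_comm])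
    have := Int.le_of_dvd (abs_pos.mpr hk0) ((dvd_abs _ _).mpr hdvd')
    have := abs_pos.mpr hk0
    lia
  have hone : (1 : ℝ) ≤ |(a : ℝ) * k - z * q| := by exact_mod_cast Int.one_le_abs hne
  have hmain : 1 / (q : ℝ) ≤ |(a : ℝ) / q * k - z| := by
    rw [show (a : ℝ) / q * k - z = (a * k - z * q) / q by field_simp, abs_div, abs_of_pos hqpos]
    gcongr
  have hkr : 2 * |(k : ℝ)| ≤ q := by exact_mod_cast hk
  have herr : |(α - (a : ℝ) / q) * k| ≤ 1 / (2 * (q : ℝ)) := by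
    rw [abs_mul]
    calc _ ≤ 1 / (q : ℝ) ^ 2 * (q / 2) := by
          gcongr
          linarith
      _ = _ := by field_simp
  have htri : |(a : ℝ) / q * k - z| ≤ |α * k - z| + |(α - (a : ℝ) / q) * k| := by
    rw [show (a : ℝ) / q * k - z = (α * k - z) - (α - (a : ℝ) / q) * k by ring]
    exact abs_sub _ _
  have : 1 / (q : ℝ) = 1 / (2 * (q : ℝ)) + 1 / (2 * (q : ℝ)) := by field_simp; norm_num
  linarith

lemma sum_range_inv_le (n : ℕ) :
    ∑ k ∈ Finset.range (n + 1), (1 : ℝ) / k ≤ 1 + Real.log n := by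
  have h := harmonic_le_one_add_log n
  rw [Finset.sum_range_succ']
  simp only [harmonic, Rat.cast_sum, Rat.cast_inv, Rat.cast_natCast] at h
  simpa using h

/-- The sum of a function dominated by `min Y ‖α h‖⁻¹` over integers `h` that are close together. -/
lemma sum_le_of_close {α : ℝ} {a : ℤ} {q : ℕ} (hq : 1 ≤ q)
    (hgcd : Int.gcd a q = 1) (hα : |α - (a : ℝ) / q| ≤ 1 / (q : ℝ) ^ 2)
    {B : Finset ℤ} (hB : ∀ h ∈ B, ∀ h' ∈ B, 2 * |h - h'| ≤ q) {φ : ℤ → ℝ} {Y : ℝ} (hY : 0 ≤ Y)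
    (hφY : ∀ h ∈ B, φ h ≤ Y) (hφ : ∀ h ∈ B, φ h * |α * h - round (α * h)| ≤ 1) :
    ∑ h ∈ B, φ h ≤ 2 * Y + 4 * q * (1 + Real.log (2 * q)) := by
  have hqpos : (0 : ℝ) < q := by exact_mod_cast hq
  set cell : ℤ → ℕ := fun h => ⌊2 * q * Int.fract (α * h)⌋₊ with hcell
  set G : ℕ → ℝ := fun c => if c = 0 then Y else 2 * q / c with hG
  have hG0 : ∀ c, 0 ≤ G c := fun c => by
    simp only [hG]
    split_ifs
    · exact hY
    · positivity
  have hGbound : ∀ (c : ℕ) (δ v : ℝ), c / (2 * q) ≤ δ → v * δ ≤ 1 → v ≤ Y → v ≤ G c := by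
    intro c δ v hc hv hvY
    simp only [hG]
    split_ifs with h0
    · exact hvY
    · have hcpos : (0 : ℝ) < c := by exact_mod_cast Nat.pos_of_ne_zero h0
      rcases le_total v 0 with hneg | hpos
      · exact hneg.trans (by positivity)
      · rw [le_div_iff₀ hcpos]
        have h1 := mul_le_mul_of_nonneg_left hc hpos
        have h2 : v * (c / (2 * q)) ≤ 1 := h1.trans hv
        rw [← mul_div_assoc, div_le_one (by positivity)] at h2
        exact h2
  have hfloor : ∀ h : ℤ, (cell h : ℝ) ≤ 2 * q * Int.fract (α * h) ∧
      2 * q * Int.fract (α * h) < cell h + 1 := fun h =>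
    ⟨Nat.floor_le (by have := Int.fract_nonneg (α * h); positivity), Nat.lt_floor_add_one _⟩
  have hcell_lt : ∀ h : ℤ, cell h < 2 * q := by
    intro h
    have h1 := (hfloor h).1
    have h2 := Int.fract_lt_one (α * h)
    have : (cell h : ℝ) < 2 * q := by nlinarith
    exact_mod_cast this
  have hinj : Set.InjOn cell B := by
    intro h hh h' hh' heq
    by_contra hne
    have hsp := one_div_two_mul_le_abs_mul_sub hq hgcd hα (sub_ne_zero.mpr hne)
      (hB h hh h' hh') (⌊α * h⌋ - ⌊α * h'⌋)
    have hf := hfloor h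
    have hf' := hfloor h'
    rw [← heq] at hf'
    have hdiff : α * ((h - h' : ℤ) : ℝ) - ((⌊α * h⌋ - ⌊α * h'⌋ : ℤ) : ℝ)
        = Int.fract (α * h) - Int.fract (α * h') := by
      simp only [Int.fract]
      push_cast
      ring
    rw [hdiff, div_le_iff₀ (by positivity)] at hsp
    have hlt : |Int.fract (α * h) - Int.fract (α * h')| * (2 * q) < 1 := by
      rw [← abs_of_pos (show (0 : ℝ) < 2 * q by positivity), ← abs_mul, abs_lt]
      constructor <;> nlinarith
    linarith
  have hpoint : ∀ h ∈ B, φ h ≤ G (cell h) + G (2 * q - 1 - cell h) := by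
    intro h hh
    have hf := hfloor h
    have hr := abs_sub_round_eq_min (α * h)
    have hv := hφ h hh
    rcases le_total (Int.fract (α * h)) (1 - Int.fract (α * h)) with hle | hle
    · rw [hr, min_eq_left hle] at hv
      have := hGbound (cell h) _ _ (by rw [div_le_iff₀ (by positivity)]; linarith) hv (hφY h hh)
      linarith [hG0 (2 * q - 1 - cell h)]
    · rw [hr, min_eq_right hle] at hv
      have hlt := hcell_lt h
      have hcast : ((2 * q - 1 - cell h : ℕ) : ℝ) = 2 * q - 1 - cell h := by
        rw [Nat.cast_sub (by lia), Nat.cast_sub (by lia)]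
        push_cast
        ring
      have := hGbound (2 * q - 1 - cell h) _ _
        (by rw [div_le_iff₀ (by positivity), hcast]; nlinarith) hv (hφY h hh)
      linarith [hG0 (cell h)]
  have hGsum : ∑ c ∈ Finset.range (2 * q), G c ≤ Y + 2 * q * (1 + Real.log (2 * q)) := by
    have hle : ∀ c ∈ Finset.range (2 * q),
        G c ≤ (if c = 0 then Y else 0) + 2 * q * (1 / (c : ℝ)) := by
      intro c _
      simp only [hG]
      split_ifs with h0
      · simp [h0]
      · rw [zero_add, mul_one_div]
    calc _ ≤ _ := Finset.sum_le_sum hle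
      _ ≤ Y + 2 * q * ∑ c ∈ Finset.range (2 * q), 1 / (c : ℝ) := by
        rw [Finset.sum_add_distrib, Finset.sum_ite_eq', if_pos (by simp; lia), Finset.mul_sum]
      _ ≤ _ := by
        have h1 := sum_range_inv_le (2 * q)
        rw [Finset.sum_range_succ] at h1
        have h2 : (0 : ℝ) ≤ 1 / ((2 * q : ℕ) : ℝ) := by positivity
        push_cast at h1 h2
        gcongr
        linarith
  calc ∑ h ∈ B, φ h ≤ ∑ h ∈ B, (G (cell h) + G (2 * q - 1 - cell h)) := Finset.sum_le_sum hpoint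
    _ = ∑ c ∈ B.image cell, (G c + G (2 * q - 1 - c)) :=
      (Finset.sum_image (f := fun c => G c + G (2 * q - 1 - c)) hinj).symm
    _ ≤ ∑ c ∈ Finset.range (2 * q), (G c + G (2 * q - 1 - c)) :=
      Finset.sum_le_sum_of_subset_of_nonneg
        (by intro c hc
            obtain ⟨h, _, rfl⟩ := Finset.mem_image.mp hc
            exact Finset.mem_range.mpr (hcell_lt h))
        (fun c _ _ => add_nonneg (hG0 _) (hG0 _))
    _ = 2 * ∑ c ∈ Finset.range (2 * q), G c := by
      rw [Finset.sum_add_distrib, Finset.sum_range_reflect G, ← two_mul]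
    _ ≤ _ := by linarith

/-- The sum of a function dominated by `min Y ‖α h‖⁻¹` over integers `h` in an interval. -/
lemma sum_le_of_subset_Ico {α : ℝ} {a : ℤ} {q : ℕ} (hq : 1 ≤ q)
    (hgcd : Int.gcd a q = 1) (hα : |α - (a : ℝ) / q| ≤ 1 / (q : ℝ) ^ 2)
    {B : Finset ℤ} {c : ℤ} {L : ℕ} (hB : B ⊆ Finset.Ico c (c + L)) {φ : ℤ → ℝ} {Y : ℝ}
    (hY : 0 ≤ Y) (hφY : ∀ h ∈ B, φ h ≤ Y) (hφ : ∀ h ∈ B, φ h * |α * h - round (α * h)| ≤ 1) :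
    ∑ h ∈ B, φ h ≤ (2 * L / q + 1) * (2 * Y + 4 * q * (1 + Real.log (2 * q))) := by
  have hqpos : (1 : ℝ) ≤ q := by exact_mod_cast hq
  set ℓ : ℕ := q / 2 + 1 with hℓ
  set key : ℤ → ℕ := fun h => (h - c).toNat / ℓ with hkey
  have hmaps : ∀ h ∈ B, key h ∈ Finset.range (L / ℓ + 1) := by
    intro h hh
    have hm := Finset.mem_Ico.mp (hB hh)
    refine Finset.mem_range.mpr (Nat.lt_succ_of_le (Nat.div_le_div_right ?_))
    lia
  have hW : 0 ≤ 2 * Y + 4 * q * (1 + Real.log (2 * q)) := by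
    have : 0 ≤ Real.log (2 * q) := Real.log_nonneg (by linarith)
    positivity
  have hcount : ((L / ℓ : ℕ) : ℝ) ≤ 2 * L / q := by
    have h1 : ((L / ℓ : ℕ) : ℝ) ≤ (L : ℝ) / ℓ := Nat.cast_div_le
    have h2 : (q : ℝ) ≤ 2 * ℓ := by
      have : q ≤ 2 * ℓ := by lia
      exact_mod_cast this
    refine h1.trans ?_
    rw [div_le_div_iff₀ (by positivity) (by linarith)]
    have : (0 : ℝ) ≤ L := by positivity
    nlinarith
  rw [← Finset.sum_fiberwise_of_maps_to hmaps]
  calc _ ≤ ∑ _k ∈ Finset.range (L / ℓ + 1), (2 * Y + 4 * q * (1 + Real.log (2 * q))) := by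
        refine Finset.sum_le_sum fun k _ => ?_
        refine sum_le_of_close hq hgcd hα ?_ hY
          (fun h hh => hφY h (Finset.mem_filter.mp hh).1)
          (fun h hh => hφ h (Finset.mem_filter.mp hh).1)
        intro h hh h' hh'
        obtain ⟨hhB, hhk⟩ := Finset.mem_filter.mp hh
        obtain ⟨hhB', hhk'⟩ := Finset.mem_filter.mp hh'
        have hm := Finset.mem_Ico.mp (hB hhB)
        have hm' := Finset.mem_Ico.mp (hB hhB')
        have e1 := Nat.div_add_mod (h - c).toNat ℓ
        have e2 := Nat.div_add_mod (h' - c).toNat ℓ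
        have l1 := Nat.mod_lt (h - c).toNat (show 0 < ℓ by lia)
        have l2 := Nat.mod_lt (h' - c).toNat (show 0 < ℓ by lia)
        simp only [hkey] at hhk hhk'
        rw [hhk] at e1
        rw [hhk'] at e2
        have : |h - h'| < ℓ := by
          rw [abs_lt]
          constructor <;> lia
        lia
    _ = ((L / ℓ : ℕ) + 1) * (2 * Y + 4 * q * (1 + Real.log (2 * q))) := by
        rw [Finset.sum_const, Finset.card_range, nsmul_eq_mul]
        push_cast
        ring
    _ ≤ _ := by gcongr

/-- The sum of a function dominated by `min (Z / h) ‖α h‖⁻¹` over positive integers `h ≤ H`. -/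
lemma sum_le_of_subset_Icc_one {α : ℝ} {a : ℤ} {q : ℕ} (hq : 1 ≤ q)
    (hgcd : Int.gcd a q = 1) (hα : |α - (a : ℝ) / q| ≤ 1 / (q : ℝ) ^ 2)
    {B : Finset ℤ} {H : ℕ} (hB : B ⊆ Finset.Icc 1 (H : ℤ)) {φ : ℤ → ℝ} {Z : ℝ}
    (hZ : 0 ≤ Z) (hφZ : ∀ h ∈ B, φ h * h ≤ Z)
    (hφ : ∀ h ∈ B, φ h * |α * h - round (α * h)| ≤ 1) :
    ∑ h ∈ B, φ h ≤ (8 * H + 4 * q) * (2 + Real.log (2 * q))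
      + 4 * Z / q * (1 + Real.log (H + 1)) := by
  have hqpos : (1 : ℝ) ≤ q := by exact_mod_cast hq
  set ℓ : ℕ := q / 2 + 1 with hℓ
  have hℓpos : (0 : ℝ) < ℓ := by positivity
  set key : ℤ → ℕ := fun h => h.toNat / ℓ with hkey
  have hmaps : ∀ h ∈ B, key h ∈ Finset.range (H / ℓ + 1) := by
    intro h hh
    have hm := Finset.mem_Icc.mp (hB hh)
    refine Finset.mem_range.mpr (Nat.lt_succ_of_le (Nat.div_le_div_right ?_))
    lia
  have hlog : 0 ≤ Real.log (2 * q) := Real.log_nonneg (by linarith)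
  have hqℓ : (q : ℝ) ≤ 2 * ℓ := by
    have : q ≤ 2 * ℓ := by lia
    exact_mod_cast this
  have hcount : ((H / ℓ : ℕ) : ℝ) ≤ 2 * H / q := by
    have h1 : ((H / ℓ : ℕ) : ℝ) ≤ (H : ℝ) / ℓ := Nat.cast_div_le
    refine h1.trans ?_
    rw [div_le_div_iff₀ (by positivity) (by linarith)]
    have : (0 : ℝ) ≤ H := by positivity
    nlinarith
  have hfiber : ∀ k ∈ Finset.range (H / ℓ + 1), ∑ h ∈ B with key h = k, φ h
      ≤ 4 * q * (2 + Real.log (2 * q)) + 2 * Z / ℓ * (1 / (k : ℝ)) := by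
    intro k _
    have hY : 0 ≤ 2 * q + Z / ℓ * (1 / (k : ℝ)) := by positivity
    have hkeyspec : ∀ h ∈ B.filter (fun h => key h = k), h ∈ B ∧ 1 ≤ h ∧
        (ℓ * k : ℤ) ≤ h ∧ h < ℓ * k + ℓ := by
      intro h hh
      obtain ⟨hhB, hhk⟩ := Finset.mem_filter.mp hh
      have hm := Finset.mem_Icc.mp (hB hhB)
      have e1 := Nat.div_add_mod h.toNat ℓ
      have l1 := Nat.mod_lt h.toNat (show 0 < ℓ by lia)
      simp only [hkey] at hhk
      rw [hhk] at e1
      have hcast : ((ℓ * k + h.toNat % ℓ : ℕ) : ℤ) = h := by rw [e1]; lia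
      push_cast at hcast
      exact ⟨hhB, hm.1, by lia, by lia⟩
    have hmain := sum_le_of_close hq hgcd hα (B := B.filter (fun h => key h = k)) (φ := φ)
      (Y := 2 * q + Z / ℓ * (1 / (k : ℝ))) ?_ hY ?_
      (fun h hh => hφ h (Finset.mem_filter.mp hh).1)
    · refine hmain.trans (le_of_eq ?_)
      ring
    · intro h hh h' hh'
      obtain ⟨-, -, h1, h2⟩ := hkeyspec h hh
      obtain ⟨-, -, h1', h2'⟩ := hkeyspec h' hh'
      have : |h - h'| < ℓ := by
        rw [abs_lt]
        constructor <;> linarith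
      lia
    · intro h hh
      obtain ⟨hhB, hh1, hlo, hhi⟩ := hkeyspec h hh
      rcases le_total (φ h) 0 with hneg | hpos
      · linarith
      rcases Nat.eq_zero_or_pos k with hk | hk
      · subst hk
        have hsp := one_div_two_mul_le_abs_mul_sub hq hgcd hα (k := h) (by lia)
          (by rw [abs_of_pos (by lia)]; push_cast at hhi; lia) (round (α * h))
        have h1 := (mul_le_mul_of_nonneg_left hsp hpos).trans (hφ h hhB)
        rw [mul_one_div, div_le_one (by positivity)] at h1
        simpa using h1
      · have hkpos : (0 : ℝ) < k := by exact_mod_cast hk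
        have hlo' : (ℓ : ℝ) * k ≤ h := by exact_mod_cast hlo
        have h1 := (mul_le_mul_of_nonneg_left hlo' hpos).trans (hφZ h hhB)
        have h2 : φ h ≤ Z / (ℓ * k) := by rwa [le_div_iff₀ (by positivity)]
        have h3 : Z / ℓ * (1 / (k : ℝ)) = Z / (ℓ * k) := by field_simp
        linarith
  rw [← Finset.sum_fiberwise_of_maps_to hmaps]
  have hharm : ∑ k ∈ Finset.range (H / ℓ + 1), 1 / (k : ℝ) ≤ 1 + Real.log (H + 1) := by
    refine (sum_range_inv_le _).trans ?_
    refine (add_le_add_iff_left 1).mpr ?_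
    rcases Nat.eq_zero_or_pos (H / ℓ) with h0 | h0
    · rw [h0]
      simpa using Real.log_nonneg (by linarith [Nat.cast_nonneg (α := ℝ) H] : (1 : ℝ) ≤ H + 1)
    · refine Real.log_le_log (by exact_mod_cast h0) ?_
      exact_mod_cast (Nat.div_le_self H ℓ).trans (Nat.le_succ H)
  have hZℓ : 2 * Z / ℓ ≤ 4 * Z / q := by
    rw [div_le_div_iff₀ hℓpos (by linarith)]
    nlinarith
  have hlogH : 0 ≤ Real.log ((H : ℝ) + 1) :=
    Real.log_nonneg (by linarith [Nat.cast_nonneg (α := ℝ) H])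
  calc _ ≤ _ := Finset.sum_le_sum hfiber
    _ = ((H / ℓ : ℕ) + 1) * (4 * q * (2 + Real.log (2 * q)))
        + 2 * Z / ℓ * ∑ k ∈ Finset.range (H / ℓ + 1), 1 / (k : ℝ) := by
      rw [Finset.sum_add_distrib, Finset.sum_const, Finset.card_range, nsmul_eq_mul,
        Finset.mul_sum]
      push_cast
      ring
    _ ≤ (2 * H / q + 1) * (4 * q * (2 + Real.log (2 * q)))
        + 4 * Z / q * (1 + Real.log (H + 1)) := by gcongr
    _ = _ := by field_simp; ring

/-- Type I estimate: a common majorant `Φ d` for the twisted sums over `n ≤ k ≤ N / d` of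
`χ(n) e(αAdn)`, together with a bound for its sum over `d ≤ D`. -/
lemma exists_twisted_sum_majorant {α : ℝ} {a : ℤ} {q : ℕ} (hq : 1 ≤ q)
    (hgcd : Int.gcd a q = 1) (hα : |α - (a : ℝ) / q| ≤ 1 / (q : ℝ) ^ 2)
    {A g : ℕ} (hA : 0 < A) (hg : 0 < g) (χ : DirichletCharacter ℂ g) (N : ℕ) :
    ∃ Φ : ℕ → ℝ, (∀ d, 0 ≤ Φ d) ∧
      (∀ d, 1 ≤ d → ∀ k ≤ N / d, ‖∑ n ∈ Finset.Ico 1 (k + 1),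
        χ (n : ZMod g) * expChar (α * (A * (d * n)))‖ ≤ Φ d) ∧
      ∀ D : ℕ, ∑ d ∈ Finset.Ico 1 (D + 1), Φ d
        ≤ g * ((8 * (A * g * D) + 4 * q) * (2 + Real.log (2 * q))
          + 4 * (A * g * N) / q * (1 + Real.log (A * g * D + 1))) := by
  set S : ℕ → ℕ → ℝ := fun d k => ‖∑ n ∈ Finset.Ico 1 (k + 1),
    χ (n : ZMod g) * expChar (α * (A * (d * n)))‖ with hS
  have hmax : ∀ d, ∃ m ∈ Finset.range (N / d + 1), ∀ k ∈ Finset.range (N / d + 1),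
      S d k ≤ S d m := fun d =>
    Finset.exists_max_image _ _ ⟨0, by simp⟩
  choose m hm hmS using hmax
  have hgpos : (0 : ℝ) < g := by exact_mod_cast hg
  have hgone : (1 : ℝ) ≤ g := by exact_mod_cast hg
  have hunorm : ∀ d n : ℕ, ‖χ (n : ZMod g) * expChar (α * (A * (d * n)))‖ ≤ 1 := fun d n => by
    rw [norm_mul, norm_expChar, mul_one]
    exact χ.norm_le_one _
  refine ⟨fun d => S d (m d), fun d => norm_nonneg _, fun d _ k hk =>
    hmS d k (Finset.mem_range.mpr (Nat.lt_succ_of_le hk)), fun D => ?_⟩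
  have hsize : ∀ d, 1 ≤ d → S d (m d) * d ≤ N := by
    intro d hd
    have h1 : S d (m d) ≤ m d := by
      simpa using norm_sum_le_of_le (Finset.Ico 1 (m d + 1)) (fun n _ => hunorm d n)
    have h2 : m d ≤ N / d := Nat.lt_succ_iff.mp (Finset.mem_range.mp (hm d))
    have h3 : m d * d ≤ N := (Nat.mul_le_mul_right d h2).trans (Nat.div_mul_le_self N d)
    calc _ ≤ (m d : ℝ) * d := by gcongr
      _ ≤ N := by exact_mod_cast h3
  have hcancel : ∀ d, S d (m d) * |α * (A * g * d) - round (α * (A * g * d))| ≤ g := by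
    intro d
    have h1 := norm_sub_one_mul_norm_sum_Ico_le (g := g) (z := expChar (α * (A * g * d)))
      (hunorm d) (fun n => by
        rw [mul_left_comm (expChar _), ← expChar_add]
        push_cast
        rw [ZMod.natCast_self, add_zero]
        ring_nf) 1 (m d + 1)
    have h2 := mul_le_mul_of_nonneg_right (four_mul_abs_sub_round_le (α * (A * g * d)))
      (norm_nonneg (∑ n ∈ Finset.Ico 1 (m d + 1),
        χ (n : ZMod g) * expChar (α * (A * (d * n)))))
    have h3 := h2.trans h1
    simp only [hS]
    nlinarith
  set T : ℕ := A * g with hT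
  have hTpos : 0 < T := Nat.mul_pos hA hg
  have hTne : (T : ℤ) ≠ 0 := by exact_mod_cast hTpos.ne'
  set ι : ℕ → ℤ := fun d => T * d with hι
  have hιinj : Set.InjOn ι (Finset.Ico 1 (D + 1)) := fun d _ d' _ h => by
    simpa [hι, hTpos.ne'] using h
  set φ : ℤ → ℝ := fun h => S (h / T).toNat (m (h / T).toNat) / g with hφ
  have hφι : ∀ d, φ (ι d) = S d (m d) / g := fun d => by
    simp [hφ, hι, Int.mul_ediv_cancel_left _ hTne]
  have hmain := sum_le_of_subset_Icc_one hq hgcd hα (B := (Finset.Ico 1 (D + 1)).image ι)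
    (H := T * D) (φ := φ) (Z := T * N) ?_ (by positivity) ?_ ?_
  · rw [Finset.sum_image hιinj] at hmain
    simp only [hφι] at hmain
    rw [← Finset.sum_div, div_le_iff₀ hgpos] at hmain
    refine hmain.trans (le_of_eq ?_)
    rw [hT]
    push_cast
    ring
  · intro h hh
    obtain ⟨d, hd, rfl⟩ := Finset.mem_image.mp hh
    have hd' := Finset.mem_Ico.mp hd
    have h1 : 1 ≤ T * d := Nat.mul_pos hTpos hd'.1
    have h2 : T * d ≤ T * D := Nat.mul_le_mul_left T (by lia)
    simp only [hι, Finset.mem_Icc]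
    exact ⟨by exact_mod_cast h1, by exact_mod_cast h2⟩
  · intro h hh
    obtain ⟨d, hd, rfl⟩ := Finset.mem_image.mp hh
    rw [hφι]
    have h1 := hsize d (Finset.mem_Ico.mp hd).1
    have h2 : S d (m d) / g ≤ S d (m d) := div_le_self (norm_nonneg _) hgone
    have h3 : S d (m d) / g * d ≤ N := (mul_le_mul_of_nonneg_right h2 (by positivity)).trans h1
    calc S d (m d) / g * (ι d : ℝ) = T * (S d (m d) / g * d) := by
          simp only [hι]
          push_cast
          ring
      _ ≤ _ := by gcongr
  · intro h hh
    obtain ⟨d, hd, rfl⟩ := Finset.mem_image.mp hh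
    rw [hφι, div_mul_eq_mul_div, div_le_one hgpos]
    have : α * (ι d : ℝ) = α * (A * g * d) := by
      simp only [hι, hT]
      push_cast
      ring
    rw [this]
    exact hcancel d

/-- Type II estimate: a bilinear form in the additive character over one dyadic block. -/
lemma norm_sq_bilinear_le {α : ℝ} {a : ℤ} {q : ℕ} (hq : 1 ≤ q)
    (hgcd : Int.gcd a q = 1) (hα : |α - (a : ℝ) / q| ≤ 1 / (q : ℝ) ^ 2)
    {A : ℕ} (hA : 0 < A) {N D : ℕ} (hD : 1 ≤ D) {s : Finset ℕ} (hs : s ⊆ Finset.Ico D (2 * D))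
    {b c : ℕ → ℂ} {M : ℝ} (hb : ∀ d, ‖b d‖ ≤ 1) (hM : 0 ≤ M) (hc : ∀ l ≤ N, ‖c l‖ ≤ M) :
    ‖∑ d ∈ s, b d * ∑ l ∈ Finset.Ico 1 (N / d + 1), c l * expChar (α * (A * (d * l)))‖ ^ 2
      ≤ D * M ^ 2 * ((N / D : ℕ) * ((2 * (A * (N / D : ℕ)) / q + 1)
        * (2 * D + 4 * q * (1 + Real.log (2 * q))))) := by
  set K : ℕ := N / D with hK
  set inner : ℕ → ℂ := fun d =>
    ∑ l ∈ Finset.Ico 1 (N / d + 1), c l * expChar (α * (A * (d * l))) with hinner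
  set top : ℕ → ℕ → ℕ := fun l l' => min (2 * D) (N / max l l' + 1) with htop
  have hinner_eq : ∀ d ∈ Finset.Ico D (2 * D), inner d = ∑ l ∈ Finset.Ico 1 (K + 1),
      if d * l ≤ N then c l * expChar (α * (A * (d * l))) else 0 := by
    intro d hd
    have hd' := Finset.mem_Ico.mp hd
    have hdpos : 0 < d := by lia
    rw [← Finset.sum_filter]
    refine Finset.sum_congr ?_ fun _ _ => rfl
    ext l
    simp only [Finset.mem_Ico, Finset.mem_filter, Nat.lt_succ_iff, Nat.le_div_iff_mul_le hdpos,
      hK, Nat.le_div_iff_mul_le (show 0 < D by lia)]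
    constructor
    · rintro ⟨h1, h2⟩
      exact ⟨⟨h1, (Nat.mul_le_mul_left l hd'.1).trans h2⟩, by rwa [mul_comm]⟩
    · rintro ⟨⟨h1, -⟩, h2⟩
      exact ⟨h1, by rwa [mul_comm]⟩
  have hexpand : ((∑ d ∈ Finset.Ico D (2 * D), ‖inner d‖ ^ 2 : ℝ) : ℂ)
      = ∑ l ∈ Finset.Ico 1 (K + 1), ∑ l' ∈ Finset.Ico 1 (K + 1),
        c l * (starRingEnd ℂ) (c l') * ∑ d ∈ Finset.Ico D (top l l'),
          expChar (α * (A * (l - l')) * d) := by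
    push_cast
    have hsq : ∀ d ∈ Finset.Ico D (2 * D), (‖inner d‖ : ℂ) ^ 2
        = ∑ l ∈ Finset.Ico 1 (K + 1), ∑ l' ∈ Finset.Ico 1 (K + 1),
          if d * l ≤ N ∧ d * l' ≤ N then
            c l * (starRingEnd ℂ) (c l') * expChar (α * (A * (l - l')) * d) else 0 := by
      intro d hd
      rw [← Complex.mul_conj', hinner_eq d hd, map_sum, Finset.sum_mul_sum]
      refine Finset.sum_congr rfl fun l _ => Finset.sum_congr rfl fun l' _ => ?_
      by_cases h1 : d * l ≤ N <;> by_cases h2 : d * l' ≤ N <;> simp only [h1, h2, if_true,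
        if_false, and_true, and_false, map_zero, mul_zero, zero_mul]
      rw [map_mul, conj_expChar, mul_mul_mul_comm, ← expChar_add]
      ring_nf
    rw [Finset.sum_congr rfl hsq, Finset.sum_comm]
    refine Finset.sum_congr rfl fun l hl => ?_
    rw [Finset.sum_comm]
    refine Finset.sum_congr rfl fun l' hl' => ?_
    rw [← Finset.sum_filter, Finset.mul_sum]
    refine Finset.sum_congr ?_ fun _ _ => rfl
    ext d
    have hl1 := (Finset.mem_Ico.mp hl).1
    have hmaxpos : 0 < max l l' := lt_of_lt_of_le hl1 (le_max_left _ _)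
    simp only [Finset.mem_Ico, Finset.mem_filter, htop, lt_min_iff, Nat.lt_succ_iff,
      Nat.le_div_iff_mul_le hmaxpos, and_assoc, and_congr_right_iff]
    intro _ _
    rcases le_total l l' with hle | hle
    · rw [max_eq_right hle]
      exact ⟨fun h => h.2, fun h => ⟨(Nat.mul_le_mul_left d hle).trans h, h⟩⟩
    · rw [max_eq_left hle]
      exact ⟨fun h => h.1, fun h => ⟨h, (Nat.mul_le_mul_left d hle).trans h⟩⟩
  have hrow : ∀ l ∈ Finset.Ico 1 (K + 1), ∑ l' ∈ Finset.Ico 1 (K + 1),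
      ‖∑ d ∈ Finset.Ico D (top l l'), expChar (α * (A * (l - l')) * d)‖
        ≤ (2 * (A * K) / q + 1) * (2 * D + 4 * q * (1 + Real.log (2 * q))) := by
    intro l _
    set Ψ : ℕ → ℝ := fun l' =>
      ‖∑ d ∈ Finset.Ico D (top l l'), expChar (α * (A * (l - l')) * d)‖ with hΨ
    have hAne : (A : ℤ) ≠ 0 := by exact_mod_cast hA.ne'
    set ι : ℕ → ℤ := fun l' => A * ((l : ℤ) - l') with hι
    have hιinj : Set.InjOn ι (Finset.Ico 1 (K + 1)) := fun x _ y _ h => by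
      simpa [hι, hA.ne'] using h
    set φ : ℤ → ℝ := fun h => Ψ ((l : ℤ) - h / A).toNat with hφ
    have hφι : ∀ l', φ (ι l') = Ψ l' := fun l' => by
      simp [hφ, hι, Int.mul_ediv_cancel_left _ hAne]
    have hmain := sum_le_of_subset_Ico hq hgcd hα (B := (Finset.Ico 1 (K + 1)).image ι)
      (c := A * ((l : ℤ) - K)) (L := A * K) (φ := φ) (Y := D) ?_ (by positivity) ?_ ?_
    · rw [Finset.sum_image hιinj] at hmain
      simp only [hφι] at hmain
      refine hmain.trans (le_of_eq ?_)
      push_cast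
      ring
    · intro h hh
      obtain ⟨l', hl', rfl⟩ := Finset.mem_image.mp hh
      have hl1 := Finset.mem_Ico.mp hl'
      have hApos : (0 : ℤ) < A := by exact_mod_cast hA
      have h1 : (1 : ℤ) ≤ l' := by exact_mod_cast hl1.1
      have h2 : (l' : ℤ) ≤ K := by exact_mod_cast Nat.lt_succ_iff.mp hl1.2
      simp only [hι, Finset.mem_Ico]
      push_cast
      constructor <;> nlinarith
    · intro h hh
      obtain ⟨l', hl', rfl⟩ := Finset.mem_image.mp hh
      rw [hφι]
      have h1 : Ψ l' ≤ ((top l l' - D : ℕ) : ℝ) := by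
        simpa using norm_sum_le_of_le (Finset.Ico D (top l l'))
          (fun d _ => (norm_expChar (α * (A * (l - l')) * d)).le)
      have h2 : top l l' - D ≤ D := by
        have : top l l' ≤ 2 * D := min_le_left _ _
        lia
      exact h1.trans (by exact_mod_cast h2)
    · intro h hh
      obtain ⟨l', hl', rfl⟩ := Finset.mem_image.mp hh
      rw [hφι]
      have hcast : α * (ι l' : ℝ) = α * (A * (l - l')) := by
        simp only [hι]
        push_cast
        ring
      rw [hcast]
      have h1 := norm_sub_one_mul_norm_sum_Ico_le (g := 1) (z := expChar (α * (A * (l - l'))))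
        (u := fun d : ℕ => expChar (α * (A * (l - l')) * d)) (fun d => (norm_expChar _).le)
        (fun d => by
          rw [← expChar_add]
          push_cast
          ring_nf) D (top l l')
      have h2 := mul_le_mul_of_nonneg_right
        (four_mul_abs_sub_round_le (α * (A * (l - l')))) (norm_nonneg
          (∑ d ∈ Finset.Ico D (top l l'), expChar (α * (A * (l - l')) * d)))
      have h3 := h2.trans h1
      simp only [hΨ]
      push_cast at h3
      nlinarith
  set W : ℝ := (2 * (A * K) / q + 1) * (2 * D + 4 * q * (1 + Real.log (2 * q))) with hW
  have hcK : ∀ l ∈ Finset.Ico 1 (K + 1), ‖c l‖ ≤ M := fun l hl =>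
    hc l ((Nat.lt_succ_iff.mp (Finset.mem_Ico.mp hl).2).trans (Nat.div_le_self N D))
  have hsquares : ∑ d ∈ Finset.Ico D (2 * D), ‖inner d‖ ^ 2 ≤ M ^ 2 * (K * W) := by
    have hnonneg : 0 ≤ ∑ d ∈ Finset.Ico D (2 * D), ‖inner d‖ ^ 2 :=
      Finset.sum_nonneg fun _ _ => by positivity
    rw [← Real.norm_of_nonneg hnonneg, ← Complex.norm_real, hexpand]
    calc _ ≤ ∑ l ∈ Finset.Ico 1 (K + 1), M ^ 2 * W := by
          refine norm_sum_le_of_le _ fun l hl => ?_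
          calc _ ≤ ∑ l' ∈ Finset.Ico 1 (K + 1), M ^ 2 *
                ‖∑ d ∈ Finset.Ico D (top l l'), expChar (α * (A * (l - l')) * d)‖ := by
                refine norm_sum_le_of_le _ fun l' hl' => ?_
                rw [norm_mul, norm_mul, RCLike.norm_conj, sq]
                gcongr
                · exact hcK l hl
                · exact hcK l' hl'
            _ ≤ _ := by
                rw [← Finset.mul_sum]
                gcongr
                exact hrow l hl
      _ = _ := by
          rw [Finset.sum_const, Nat.card_Ico, nsmul_eq_mul]
          push_cast
          ring_nf
  have hcard : (s.card : ℝ) ≤ D := by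
    have h1 := Finset.card_le_card hs
    rw [Nat.card_Ico] at h1
    exact_mod_cast h1.trans (by lia)
  have hnorm : ‖∑ d ∈ s, b d * inner d‖ ≤ ∑ d ∈ s, ‖inner d‖ := by
    refine norm_sum_le_of_le _ fun d _ => ?_
    rw [norm_mul]
    exact mul_le_of_le_one_left (norm_nonneg _) (hb d)
  calc _ ≤ (∑ d ∈ s, ‖inner d‖) ^ 2 := by gcongr
    _ ≤ s.card * ∑ d ∈ s, ‖inner d‖ ^ 2 := sq_sum_le_card_mul_sum_sq
    _ ≤ D * (M ^ 2 * (K * W)) := by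
      have hsub : ∑ d ∈ s, ‖inner d‖ ^ 2 ≤ ∑ d ∈ Finset.Ico D (2 * D), ‖inner d‖ ^ 2 :=
        Finset.sum_le_sum_of_subset_of_nonneg hs fun _ _ _ => by positivity
      gcongr
      exact hsub.trans hsquares
    _ = _ := by ring

/-- The main factor of the minor arc bound, without logarithms. -/
noncomputable def minorArcFactor (x : ℝ) (q : ℕ) : ℝ :=
  x ^ ((4 : ℝ) / 5) + x * (q : ℝ) ^ (-(1 : ℝ) / 2) + x ^ ((1 : ℝ) / 2) * (q : ℝ) ^ ((1 : ℝ) / 2)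

lemma minorArcFactor_mono {x y : ℝ} (hx : 0 ≤ x) (hxy : x ≤ y) (q : ℕ) :
    minorArcFactor x q ≤ minorArcFactor y q := by
  unfold minorArcFactor
  gcongr

lemma rpow_le_minorArcFactor {x : ℝ} (hx : 0 ≤ x) (q : ℕ) :
    x ^ ((4 : ℝ) / 5) ≤ minorArcFactor x q := by
  unfold minorArcFactor
  have h1 : 0 ≤ x * (q : ℝ) ^ (-(1 : ℝ) / 2) := by positivity
  have h2 : 0 ≤ x ^ ((1 : ℝ) / 2) * (q : ℝ) ^ ((1 : ℝ) / 2) := by positivity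
  linarith

lemma sq_sum_le_minorArcFactor_sq {x : ℝ} (hx : 0 < x) {q : ℕ} (hq : 1 ≤ q) :
    x * x ^ ((3 : ℝ) / 5) + x ^ 2 / q + x * q ≤ minorArcFactor x q ^ 2 := by
  have hqpos : (0 : ℝ) < q := by exact_mod_cast hq
  have h1 : (x ^ ((4 : ℝ) / 5)) ^ 2 = x * x ^ ((3 : ℝ) / 5) := by
    rw [← Real.rpow_natCast, ← Real.rpow_mul hx.le, ← Real.rpow_one_add' hx.le (by norm_num)]
    norm_num
  have h2 : (x * (q : ℝ) ^ (-(1 : ℝ) / 2)) ^ 2 = x ^ 2 / q := by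
    rw [mul_pow, ← Real.rpow_natCast ((q : ℝ) ^ _), ← Real.rpow_mul hqpos.le]
    norm_num [Real.rpow_neg_one, div_eq_mul_inv]
  have h3 : (x ^ ((1 : ℝ) / 2) * (q : ℝ) ^ ((1 : ℝ) / 2)) ^ 2 = x * q := by
    rw [mul_pow, ← Real.sqrt_eq_rpow, ← Real.sqrt_eq_rpow, Real.sq_sqrt hx.le,
      Real.sq_sqrt hqpos.le]
  rw [← h1, ← h2, ← h3]
  unfold minorArcFactor
  have p1 : 0 ≤ x ^ ((4 : ℝ) / 5) := by positivity
  have p2 : 0 ≤ x * (q : ℝ) ^ (-(1 : ℝ) / 2) := by positivity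
  have p3 : 0 ≤ x ^ ((1 : ℝ) / 2) * (q : ℝ) ^ ((1 : ℝ) / 2) := by positivity
  nlinarith [mul_nonneg p1 p2, mul_nonneg p1 p3, mul_nonneg p2 p3]

lemma minorArcFactor_nonneg {x : ℝ} (hx : 0 ≤ x) (q : ℕ) : 0 ≤ minorArcFactor x q :=
  (by positivity : (0 : ℝ) ≤ x ^ ((4 : ℝ) / 5)).trans (rpow_le_minorArcFactor hx q)

lemma le_minorArcFactor_of_le {x : ℝ} (hx : 0 < x) {q : ℕ} (hq : 1 ≤ q) (hxq : x ≤ q) :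
    x ≤ minorArcFactor x q := by
  refine (sq_le_sq₀ hx.le (minorArcFactor_nonneg hx.le q)).mp
    (le_trans ?_ (sq_sum_le_minorArcFactor_sq hx hq))
  have h1 : 0 ≤ x * x ^ ((3 : ℝ) / 5) := by positivity
  have h2 : 0 ≤ x ^ 2 / q := by positivity
  nlinarith

lemma natCast_le_minorArcFactor {x : ℝ} (hx : 0 < x) {q : ℕ} (hq : 1 ≤ q) (hqx : (q : ℝ) ≤ x) :
    (q : ℝ) ≤ minorArcFactor x q := by
  refine (sq_le_sq₀ (by positivity) (minorArcFactor_nonneg hx.le q)).mp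
    (le_trans ?_ (sq_sum_le_minorArcFactor_sq hx hq))
  have h1 : 0 ≤ x * x ^ ((3 : ℝ) / 5) := by positivity
  have h2 : 0 ≤ x ^ 2 / q := by positivity
  nlinarith [Nat.cast_nonneg (α := ℝ) q]

lemma div_le_minorArcFactor {x : ℝ} (hx : 0 < x) {q : ℕ} (hq : 1 ≤ q) :
    x / q ≤ minorArcFactor x q := by
  refine (sq_le_sq₀ (by positivity) (minorArcFactor_nonneg hx.le q)).mp
    (le_trans ?_ (sq_sum_le_minorArcFactor_sq hx hq))
  have h1 : 0 ≤ x * x ^ ((3 : ℝ) / 5) := by positivity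
  have h2 : 0 ≤ x * q := by positivity
  have hq1 : (1 : ℝ) ≤ q := by exact_mod_cast hq
  have h3 : (x / q) ^ 2 ≤ x ^ 2 / q := by
    rw [div_pow]
    gcongr
    nlinarith
  linarith

lemma one_le_two_mul_log {N : ℕ} (hN : 2 ≤ N) : 1 ≤ 2 * Real.log N := by
  have h1 : Real.log 2 ≤ Real.log N := Real.log_le_log (by norm_num) (by exact_mod_cast hN)
  linarith [Real.log_two_gt_d9]

lemma one_add_log_two_mul_le {N q : ℕ} (hN : 2 ≤ N) (hq : 1 ≤ q) (hqN : q ≤ N) :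
    1 + Real.log (2 * q) ≤ 4 * Real.log N := by
  have hqpos : (0 : ℝ) < q := by exact_mod_cast hq
  have h1 : Real.log 2 ≤ Real.log N := Real.log_le_log (by norm_num) (by exact_mod_cast hN)
  have h2 : Real.log q ≤ Real.log N := Real.log_le_log hqpos (by exact_mod_cast hqN)
  rw [Real.log_mul (by norm_num) hqpos.ne']
  linarith [one_le_two_mul_log hN]

lemma bilinear_block_factor_le {A W R X M D K N q : ℝ} (hq : 0 < q) (hA : 1 ≤ A) (hW : 1 ≤ W)
    (hD : 0 ≤ D) (hK : 0 ≤ K) (hDK : D * K ≤ N) (hDR : D ≤ R) (hKR : K ≤ 2 * R)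
    (hX : N * R + N ^ 2 / q + N * q ≤ X ^ 2) :
    D * M ^ 2 * (K * ((2 * (A * K) / q + 1) * (2 * D + 4 * q * W)))
      ≤ M ^ 2 * (20 * A * W * X ^ 2) := by
  have hDK0 : 0 ≤ D * K := mul_nonneg hD hK
  have hN : 0 ≤ N := hDK0.trans hDK
  have hR : 0 ≤ R := hD.trans hDR
  have hAWA : A ≤ A * W := le_mul_of_one_le_right (by linarith) hW
  have hAWW : W ≤ A * W := le_mul_of_one_le_left (by linarith) hA
  have e1 : D * M ^ 2 * (K * ((2 * (A * K) / q + 1) * (2 * D + 4 * q * W)))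
      = M ^ 2 * ((D * K) * (4 * A * ((D * K) / q) + 2 * D + 8 * (A * W) * K + 4 * W * q)) := by
    field_simp
    ring
  rw [e1]
  refine mul_le_mul_of_nonneg_left ?_ (sq_nonneg M)
  have hNq : (D * K) / q ≤ N / q := by gcongr
  have hNq0 : 0 ≤ N / q := by positivity
  have t1 : 4 * A * ((D * K) / q) ≤ 20 * (A * W) * (N / q) :=
    mul_le_mul (by linarith) hNq (by positivity) (by linarith)
  have t2 : 2 * D + 8 * (A * W) * K ≤ 20 * (A * W) * R := by
    have h1 : 8 * (A * W) * K ≤ 8 * (A * W) * (2 * R) :=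
      mul_le_mul_of_nonneg_left hKR (by linarith)
    have h2 : 1 * R ≤ A * W * R := mul_le_mul_of_nonneg_right (by linarith) hR
    linarith
  have t3 : 4 * W * q ≤ 20 * (A * W) * q := mul_le_mul_of_nonneg_right (by linarith) hq.le
  have hAW0 : 0 ≤ A * W := by linarith
  calc (D * K) * (4 * A * ((D * K) / q) + 2 * D + 8 * (A * W) * K + 4 * W * q)
      ≤ (D * K) * (20 * (A * W) * (R + N / q + q)) :=
        mul_le_mul_of_nonneg_left (by linarith) hDK0
    _ ≤ N * (20 * (A * W) * (R + N / q + q)) := mul_le_mul_of_nonneg_right hDK (by positivity)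
    _ = 20 * A * W * (N * R + N ^ 2 / q + N * q) := by ring
    _ ≤ _ := mul_le_mul_of_nonneg_left hX (by positivity)

/-- Type II estimate for a bilinear form over the hyperbolic region `d * l ≤ N` with both
variables larger than `N ^ (2 / 5)`. -/
lemma norm_bilinear_hyperbola_le {α : ℝ} {a : ℤ} {q : ℕ} (hq : 1 ≤ q)
    (hgcd : Int.gcd a q = 1) (hα : |α - (a : ℝ) / q| ≤ 1 / (q : ℝ) ^ 2)
    {A : ℕ} (hA : 0 < A) {N U : ℕ} (hN : 2 ≤ N) (hqN : q ≤ N)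
    (hU : (N : ℝ) ^ ((2 : ℝ) / 5) < U + 1)
    {b c : ℕ → ℂ} (hb : ∀ d, ‖b d‖ ≤ 1) (hbU : ∀ d ≤ U, b d = 0)
    (hc : ∀ l ≤ N, ‖c l‖ ≤ Real.log N) (hcU : ∀ l ≤ U, c l = 0) :
    ‖∑ d ∈ Finset.Ico 1 (N + 1), b d *
        ∑ l ∈ Finset.Ico 1 (N / d + 1), c l * expChar (α * (A * (d * l)))‖
      ≤ 240 * A * minorArcFactor N q * Real.log N ^ 3 := by
  have hNpos : (0 : ℝ) < N := by positivity
  have hqpos : (0 : ℝ) < q := by exact_mod_cast hq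
  have hA1 : (1 : ℝ) ≤ A := by exact_mod_cast hA
  set L : ℝ := Real.log N with hL
  set X : ℝ := minorArcFactor N q with hX
  have hX0 : 0 ≤ X := minorArcFactor_nonneg hNpos.le q
  have hL2 : 1 ≤ 2 * L := one_le_two_mul_log hN
  have hL0 : 0 < L := by linarith
  set W : ℝ := 1 + Real.log (2 * q) with hW
  have hW1 : 1 ≤ W := by
    have : 0 ≤ Real.log (2 * (q : ℝ)) := Real.log_nonneg (by
      have : (1 : ℝ) ≤ q := by exact_mod_cast hq
      linarith)
    linarith
  have hWL : W ≤ 4 * L := one_add_log_two_mul_le hN hq hqN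
  set R : ℝ := (N : ℝ) ^ ((3 : ℝ) / 5) with hR
  have hR0 : 0 ≤ R := by positivity
  have hRN : (N : ℝ) ^ ((2 : ℝ) / 5) * R = N := by
    rw [hR, ← Real.rpow_add hNpos]
    norm_num
  have hP0 : 0 < (N : ℝ) ^ ((2 : ℝ) / 5) := by positivity
  have hblock : ∀ j : ℕ, ‖∑ d ∈ Finset.Ico 1 (N + 1) with Nat.log 2 d = j, b d *
      ∑ l ∈ Finset.Ico 1 (N / d + 1), c l * expChar (α * (A * (d * l)))‖ ≤ 80 * A * X * L ^ 2 := by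
    intro j
    have hrhs : 0 ≤ 80 * A * X * L ^ 2 := by positivity
    have hmem : ∀ d ∈ (Finset.Ico 1 (N + 1)).filter (fun d => Nat.log 2 d = j),
        2 ^ j ≤ d ∧ d < 2 * 2 ^ j := by
      intro d hd
      obtain ⟨hd1, rfl⟩ := Finset.mem_filter.mp hd
      have hd0 : d ≠ 0 := by have := (Finset.mem_Ico.mp hd1).1; lia
      exact ⟨Nat.pow_log_le_self 2 hd0, by
        have := Nat.lt_pow_succ_log_self (b := 2) (by norm_num) d
        rwa [pow_succ, mul_comm] at this⟩
    set D : ℕ := 2 ^ j with hD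
    have hD1 : 1 ≤ D := Nat.one_le_two_pow
    have hDpos : (0 : ℝ) < D := by exact_mod_cast hD1
    rcases Nat.lt_or_ge (U + 1) (2 * D) with hDU | hDU
    swap
    · rw [Finset.sum_eq_zero fun d hd => by
        rw [hbU d (by have := (hmem d hd).2; lia), zero_mul], norm_zero]
      exact hrhs
    rcases Nat.lt_or_ge U (N / D) with hKU | hKU
    swap
    · rw [Finset.sum_eq_zero fun d hd => ?_, norm_zero]
      · exact hrhs
      · rw [Finset.sum_eq_zero fun l hl => ?_, mul_zero]
        have hl2 : l ≤ N / d := Nat.lt_succ_iff.mp (Finset.mem_Ico.mp hl).2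
        have hND : N / d ≤ N / D := Nat.div_le_div_left (hmem d hd).1 hD1
        rw [hcU l (by lia), zero_mul]
    have hsq := norm_sq_bilinear_le hq hgcd hα hA (N := N) hD1
      (s := (Finset.Ico 1 (N + 1)).filter (fun d => Nat.log 2 d = j))
      (fun d hd => Finset.mem_Ico.mpr (hmem d hd)) hb hL0.le hc
    set K : ℕ := N / D with hK
    have hDK : (D : ℝ) * K ≤ N := by exact_mod_cast Nat.mul_div_le N D
    have hDU' : (U : ℝ) + 1 < 2 * D := by exact_mod_cast hDU
    have hKU' : (U : ℝ) + 1 ≤ K := by exact_mod_cast hKU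
    have hKpos : (0 : ℝ) < K := by linarith
    have hDR : (D : ℝ) ≤ R := by
      have h1 : (N : ℝ) ^ ((2 : ℝ) / 5) * D ≤ (N : ℝ) ^ ((2 : ℝ) / 5) * R := by
        rw [hRN]
        nlinarith
      exact le_of_mul_le_mul_left h1 hP0
    have hKR : (K : ℝ) ≤ 2 * R := by
      have h1 : (N : ℝ) ^ ((2 : ℝ) / 5) * K ≤ (N : ℝ) ^ ((2 : ℝ) / 5) * (2 * R) := by
        nlinarith
      exact le_of_mul_le_mul_left h1 hP0
    have hfactor := bilinear_block_factor_le (M := L) hqpos hA1 hW1 hDpos.le hKpos.le hDK hDR hKR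
      (sq_sum_le_minorArcFactor_sq hNpos hq)
    refine (sq_le_sq₀ (norm_nonneg _) hrhs).mp (hsq.trans (hfactor.trans ?_))
    have hAL : 1 ≤ 80 * (A * L) := by nlinarith
    calc L ^ 2 * (20 * A * W * X ^ 2) ≤ L ^ 2 * (20 * A * (4 * L) * X ^ 2) := by gcongr
      _ = (L * X) ^ 2 * (80 * (A * L)) := by ring
      _ ≤ (L * X) ^ 2 * (80 * (A * L) * (80 * (A * L))) := by
        exact mul_le_mul_of_nonneg_left (le_mul_of_one_le_left (zero_le_one.trans hAL) hAL)
          (sq_nonneg _)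
      _ = _ := by ring
  have hmaps : ∀ d ∈ Finset.Ico 1 (N + 1), Nat.log 2 d ∈ Finset.range (Nat.log 2 N + 1) :=
    fun d hd => Finset.mem_range.mpr (Nat.lt_succ_of_le
      (Nat.log_mono_right (Nat.lt_succ_iff.mp (Finset.mem_Ico.mp hd).2)))
  rw [← Finset.sum_fiberwise_of_maps_to hmaps]
  have hcount : ((Nat.log 2 N + 1 : ℕ) : ℝ) ≤ 3 * L := by
    have h1 : ((2 ^ Nat.log 2 N : ℕ) : ℝ) ≤ N := by
      exact_mod_cast Nat.pow_log_le_self 2 (by lia)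
    have h2 := Real.log_le_log (by positivity) h1
    push_cast at h2 ⊢
    rw [Real.log_pow] at h2
    have h3 : Real.log 2 ≤ L := Real.log_le_log (by norm_num) (by exact_mod_cast hN)
    nlinarith [Real.log_two_gt_d9, Nat.cast_nonneg (α := ℝ) (Nat.log 2 N)]
  calc _ ≤ ∑ _j ∈ Finset.range (Nat.log 2 N + 1), 80 * A * X * L ^ 2 :=
        norm_sum_le_of_le _ fun j _ => hblock j
    _ = ((Nat.log 2 N + 1 : ℕ) : ℝ) * (80 * A * X * L ^ 2) := by
        rw [Finset.sum_const, Finset.card_range, nsmul_eq_mul]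
    _ ≤ 3 * L * (80 * A * X * L ^ 2) := by gcongr
    _ = _ := by ring

/-- The restriction of an arithmetic function to arguments `n ≤ U`. -/
def ArithmeticFunction.truncLE (f : ArithmeticFunction ℝ) (U : ℕ) : ArithmeticFunction ℝ :=
  ⟨fun n => if n ≤ U then f n else 0, by simp⟩

lemma ArithmeticFunction.truncLE_apply (f : ArithmeticFunction ℝ) (U n : ℕ) :
    f.truncLE U n = if n ≤ U then f n else 0 := rfl

open ArithmeticFunction in
/-- Vaughan's identity. -/
lemma ArithmeticFunction.vonMangoldt_eq_vaughan (U : ℕ) :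
    vonMangoldt = vonMangoldt.truncLE U + (moebius : ArithmeticFunction ℝ).truncLE U * log
      - (moebius : ArithmeticFunction ℝ).truncLE U * vonMangoldt.truncLE U * zeta
      + ((moebius : ArithmeticFunction ℝ) - (moebius : ArithmeticFunction ℝ).truncLE U)
        * (zeta * (vonMangoldt - vonMangoldt.truncLE U)) := by
  have h1 := vonMangoldt_mul_zeta
  have h2 : (moebius : ArithmeticFunction ℝ) * zeta = 1 := coe_moebius_mul_coe_zeta
  linear_combination (vonMangoldt.truncLE U - vonMangoldt) * h2
    + (moebius : ArithmeticFunction ℝ).truncLE U * h1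

open ArithmeticFunction in
lemma ArithmeticFunction.abs_mul_apply_le_log {f h : ArithmeticFunction ℝ}
    (hh : ∀ n, |h n| ≤ 1) (hf : ∀ n, |f n| ≤ Λ n) (n : ℕ) : |(h * f) n| ≤ Real.log n := by
  rw [mul_apply, ← vonMangoldt_sum, ← Nat.sum_divisorsAntidiagonal' (fun _ j => Λ j)]
  refine (Finset.abs_sum_le_sum_abs _ _).trans (Finset.sum_le_sum fun x _ => ?_)
  rw [abs_mul]
  calc _ ≤ 1 * Λ x.2 := mul_le_mul (hh _) (hf _) (abs_nonneg _) zero_le_one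
    _ = _ := one_mul _

/-- Weighted sums of a Dirichlet convolution as double sums. -/
lemma ArithmeticFunction.sum_mul_apply_mul (f h : ArithmeticFunction ℝ) (F : ℕ → ℂ) (N : ℕ) :
    ∑ n ∈ Finset.Ico 1 (N + 1), ((f * h) n : ℂ) * F n
      = ∑ d ∈ Finset.Ico 1 (N + 1), ∑ m ∈ Finset.Ico 1 (N / d + 1),
        (f d : ℂ) * ((h m : ℂ) * F (d * m)) := by
  have hleft : ∀ n ∈ Finset.Ico 1 (N + 1), ((f * h) n : ℂ) * F n
      = ∑ x ∈ Finset.Ico 1 (N + 1) ×ˢ Finset.Ico 1 (N + 1),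
        if x.1 * x.2 = n then (f x.1 : ℂ) * ((h x.2 : ℂ) * F (x.1 * x.2)) else 0 := by
    intro n hn
    have hn' := Finset.mem_Ico.mp hn
    rw [mul_apply, Nat.divisorsAntidiagonal_eq_prod_filter_of_le (by lia)
      (Nat.lt_succ_iff.mp hn'.2), ← Finset.sum_filter, Complex.ofReal_sum, Finset.sum_mul]
    refine Finset.sum_congr (by ext; simp [Nat.succ_le_iff]) fun x hx => ?_
    rw [(Finset.mem_filter.mp hx).2, Complex.ofReal_mul, mul_assoc]
  rw [Finset.sum_congr rfl hleft, Finset.sum_comm, Finset.sum_product]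
  refine Finset.sum_congr rfl fun d hd => ?_
  have hd1 := (Finset.mem_Ico.mp hd).1
  simp only [Finset.sum_ite_eq]
  rw [← Finset.sum_filter]
  refine Finset.sum_congr ?_ fun _ _ => rfl
  ext m
  simp only [Finset.mem_filter, Finset.mem_Ico, Nat.lt_succ_iff,
    Nat.le_div_iff_mul_le (show 0 < d from hd1)]
  constructor
  · rintro ⟨⟨h1, -⟩, -, h3⟩
    exact ⟨h1, by rwa [mul_comm]⟩
  · rintro ⟨h1, h2⟩
    exact ⟨⟨h1, (Nat.le_mul_of_pos_right m hd1).trans h2⟩, Nat.mul_pos hd1 h1,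
      by rwa [mul_comm]⟩

lemma abs_moebius_coe_le_one (n : ℕ) :
    |(ArithmeticFunction.moebius : ArithmeticFunction ℝ) n| ≤ 1 := by
  rw [ArithmeticFunction.intCoe_apply]
  exact_mod_cast ArithmeticFunction.abs_moebius_le_one

lemma ArithmeticFunction.abs_truncLE_le (f : ArithmeticFunction ℝ) (U n : ℕ) :
    |f.truncLE U n| ≤ |f n| := by
  rw [truncLE_apply]
  split_ifs <;> simp

lemma ArithmeticFunction.sub_truncLE_apply (f : ArithmeticFunction ℝ) (U n : ℕ) :
    (f - f.truncLE U) n = if n ≤ U then 0 else f n := by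
  change f n - f.truncLE U n = _
  rw [truncLE_apply]
  split_ifs <;> simp

lemma ArithmeticFunction.abs_sub_truncLE_le (f : ArithmeticFunction ℝ) (U n : ℕ) :
    |(f - f.truncLE U) n| ≤ |f n| := by
  rw [sub_truncLE_apply]
  split_ifs <;> simp

lemma ArithmeticFunction.mul_apply_eq_zero_of_lt {f h : ArithmeticFunction ℝ} {U V : ℕ}
    (hf : ∀ n, U < n → f n = 0) (hh : ∀ n, V < n → h n = 0) {n : ℕ} (hn : U * V < n) :
    (f * h) n = 0 := by
  rw [mul_apply]
  refine Finset.sum_eq_zero fun x hx => ?_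
  have hx' := (Nat.mem_divisorsAntidiagonal.mp hx).1
  rcases Nat.lt_or_ge U x.1 with h1 | h1
  · rw [hf _ h1, zero_mul]
  · rcases Nat.lt_or_ge V x.2 with h2 | h2
    · rw [hh _ h2, mul_zero]
    · exact absurd (Nat.mul_le_mul h1 h2) (by lia)

lemma ArithmeticFunction.mul_apply_eq_zero_of_le {f h : ArithmeticFunction ℝ} {U : ℕ}
    (hh : ∀ n ≤ U, h n = 0) {n : ℕ} (hn : n ≤ U) : (f * h) n = 0 := by
  rw [mul_apply]
  refine Finset.sum_eq_zero fun x hx => ?_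
  have hx' := Nat.mem_divisorsAntidiagonal.mp hx
  have : x.2 ≤ n := Nat.le_of_dvd (Nat.pos_of_ne_zero hx'.2) ⟨x.1, by rw [← hx'.1, mul_comm]⟩
  rw [hh _ (this.trans hn), mul_zero]

/-- Twisted sums of a Dirichlet convolution as bilinear forms. -/
lemma ArithmeticFunction.sum_mul_apply_mul_twist (f h : ArithmeticFunction ℝ) {g : ℕ}
    (χ : DirichletCharacter ℂ g) (α : ℝ) (A N : ℕ) :
    ∑ n ∈ Finset.Ico 1 (N + 1), ((f * h) n : ℂ) * (χ (n : ZMod g) * expChar (α * (A * n)))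
      = ∑ d ∈ Finset.Ico 1 (N + 1), ((f d : ℂ) * χ (d : ZMod g)) *
        ∑ m ∈ Finset.Ico 1 (N / d + 1),
          ((h m : ℂ) * χ (m : ZMod g)) * expChar (α * (A * (d * m))) := by
  rw [sum_mul_apply_mul f h fun n => χ (n : ZMod g) * expChar (α * (A * n))]
  refine Finset.sum_congr rfl fun d _ => ?_
  rw [Finset.mul_sum]
  refine Finset.sum_congr rfl fun m _ => ?_
  push_cast
  rw [map_mul]
  ring

/-- Type I estimate in terms of bounds for the inner sums. -/
lemma norm_sum_convolution_twist_le {f h : ArithmeticFunction ℝ} {g : ℕ}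
    {χ : DirichletCharacter ℂ g} {α : ℝ} {A N D : ℕ} {M B : ℝ} {Φ : ℕ → ℝ} (hM : 0 ≤ M)
    (hB : 0 ≤ B) (hΦ : ∀ d, 0 ≤ Φ d) (hf : ∀ d ≤ N, |f d| ≤ M) (hfD : ∀ d, D < d → f d = 0)
    (hh : ∀ d, 1 ≤ d → d ≤ N → ‖∑ m ∈ Finset.Ico 1 (N / d + 1),
      (h m : ℂ) * (χ (m : ZMod g) * expChar (α * (A * (d * m))))‖ ≤ B * Φ d) :
    ‖∑ n ∈ Finset.Ico 1 (N + 1), ((f * h) n : ℂ) * (χ (n : ZMod g) * expChar (α * (A * n)))‖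
      ≤ M * (B * ∑ d ∈ Finset.Ico 1 (D + 1), Φ d) := by
  rw [ArithmeticFunction.sum_mul_apply_mul_twist, Finset.mul_sum, Finset.mul_sum]
  calc _ ≤ ∑ d ∈ Finset.Ico 1 (N + 1), if d ∈ Finset.Ico 1 (D + 1) then M * (B * Φ d) else 0 := by
        refine norm_sum_le_of_le _ fun d hd => ?_
        have hd' := Finset.mem_Ico.mp hd
        split_ifs with hdD
        · rw [norm_mul, norm_mul, Complex.norm_real, Real.norm_eq_abs]
          have h1 : |f d| * ‖χ (d : ZMod g)‖ ≤ M * 1 :=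
            mul_le_mul (hf d (by lia)) (χ.norm_le_one _) (norm_nonneg _) hM
          have h2 := hh d hd'.1 (by lia)
          simp only [← mul_assoc] at h2 ⊢
          simp only [mul_one, mul_assoc] at h1 h2 ⊢
          rw [← mul_assoc]
          exact mul_le_mul h1 h2 (norm_nonneg _) hM
        · rw [hfD d (by simp only [Finset.mem_Ico] at hdD; lia)]
          simp
    _ = ∑ d ∈ Finset.Ico 1 (N + 1) with d ∈ Finset.Ico 1 (D + 1), M * (B * Φ d) :=
        (Finset.sum_filter _ _).symm
    _ ≤ _ := Finset.sum_le_sum_of_subset_of_nonneg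
        (fun d hd => (Finset.mem_filter.mp hd).2)
        fun d _ _ => mul_nonneg hM (mul_nonneg hB (hΦ d))

lemma typeI_majorant_le {q N A g D : ℕ} (hq : 1 ≤ q) (hqN : q ≤ N) (hN : 2 ≤ N) (hA : 0 < A)
    (hg : 0 < g) (hD : (D : ℝ) ≤ (N : ℝ) ^ ((4 : ℝ) / 5)) :
    g * ((8 * (A * g * D) + 4 * q) * (2 + Real.log (2 * q))
          + 4 * (A * g * N) / q * (1 + Real.log (A * g * D + 1)))
      ≤ 88 * g * (A * g) ^ 2 * (minorArcFactor N q * Real.log N) := by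
  have hN2 : (2 : ℝ) ≤ N := by exact_mod_cast hN
  have hNpos : (0 : ℝ) < N := by linarith
  have hT : (1 : ℝ) ≤ (A * g : ℝ) := by exact_mod_cast Nat.mul_pos hA hg
  have hDX := hD.trans (rpow_le_minorArcFactor hNpos.le q)
  have hqX := natCast_le_minorArcFactor hNpos hq (by exact_mod_cast hqN)
  have hNqX := div_le_minorArcFactor hNpos hq
  have hDN : (D : ℝ) ≤ N := hD.trans <| by
    conv_rhs => rw [← Real.rpow_one (N : ℝ)]
    exact Real.rpow_le_rpow_of_exponent_le (by linarith) (by norm_num)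
  have hL2 := one_le_two_mul_log hN
  have hW := one_add_log_two_mul_le hN hq hqN
  have hX0 := minorArcFactor_nonneg hNpos.le q
  have hlog : 1 + Real.log (A * g * D + 1) ≤ 4 * (A * g) * Real.log N := by
    have h1 : (A * g * D + 1 : ℝ) ≤ A * g * N ^ 2 := by
      have h2 : (D + 1 : ℝ) ≤ N ^ 2 := by nlinarith
      have h3 := mul_le_mul_of_nonneg_left h2 (zero_le_one.trans hT)
      linarith
    have h4 := Real.log_le_log (by positivity) h1
    rw [Real.log_mul (by positivity) (by positivity), Real.log_pow] at h4
    have h5 := Real.log_le_sub_one_of_pos (zero_lt_one.trans_le hT)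
    push_cast at h4
    nlinarith
  generalize (A * g : ℝ) = T at *
  generalize minorArcFactor N q = X at *
  have hL0 : 0 ≤ Real.log N := by linarith
  generalize Real.log N = L at *
  have hW0 : 0 ≤ 2 + Real.log (2 * q) := by
    have : 0 ≤ Real.log (2 * (q : ℝ)) := Real.log_nonneg (by
      have : (1 : ℝ) ≤ q := by exact_mod_cast hq
      linarith)
    linarith
  have s1 : (8 * (T * D) + 4 * q) * (2 + Real.log (2 * q)) ≤ (12 * (T * X)) * (6 * L) := by
    refine mul_le_mul ?_ (by linarith) hW0 (by positivity)
    have h1 : T * D ≤ T * X := mul_le_mul_of_nonneg_left hDX (by linarith)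
    have h2 : 1 * X ≤ T * X := mul_le_mul_of_nonneg_right hT hX0
    linarith
  have s2 : 4 * (T * N) / q * (1 + Real.log (T * D + 1)) ≤ 4 * T * X * (4 * T * L) := by
    refine mul_le_mul ?_ hlog ?_ (by positivity)
    · rw [show 4 * (T * N) / q = 4 * T * ((N : ℝ) / q) by ring]
      exact mul_le_mul_of_nonneg_left hNqX (by positivity)
    · have : 0 ≤ Real.log (T * D + 1) := Real.log_nonneg (by
        have : 0 ≤ T * D := by positivity
        linarith)
      linarith
  have s3 : 12 * (T * X) * (6 * L) + 4 * T * X * (4 * T * L) ≤ 88 * T ^ 2 * (X * L) := by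
    have h1 : T * (X * L) ≤ T * T * (X * L) :=
      mul_le_mul_of_nonneg_right (le_mul_of_one_le_left (by linarith) hT) (by positivity)
    linarith
  calc _ ≤ g * (88 * T ^ 2 * (X * L)) :=
        mul_le_mul_of_nonneg_left (by linarith) (Nat.cast_nonneg g)
    _ = _ := by ring

/-- The bound for the twisted exponential sum over an initial segment of length `N`. -/
lemma norm_sum_vonMangoldt_twist_le {α : ℝ} {a : ℤ} {q : ℕ} (hq : 1 ≤ q)
    (hgcd : Int.gcd a q = 1) (hα : |α - (a : ℝ) / q| ≤ 1 / (q : ℝ) ^ 2)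
    {A g : ℕ} (hA : 0 < A) (hg : 0 < g) (χ : DirichletCharacter ℂ g) {N : ℕ} (hN : 2 ≤ N) :
    ‖∑ n ∈ Finset.Ico 1 (N + 1), (ArithmeticFunction.vonMangoldt n : ℂ)
        * (χ (n : ZMod g) * expChar (α * (A * n)))‖
      ≤ (4 + 528 * g * (A * g) ^ 2 + 240 * A) * minorArcFactor N q * Real.log N ^ 3 := by
  have hNpos : (0 : ℝ) < N := by positivity
  have hL2 := one_le_two_mul_log hN
  have hX0 := minorArcFactor_nonneg hNpos.le q
  have hL0 : 0 ≤ Real.log N := by linarith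
  have hlog : ∀ n ≤ N, Real.log n ≤ Real.log N := fun n hn => by
    rcases Nat.eq_zero_or_pos n with rfl | h
    · simpa using hL0
    · exact Real.log_le_log (by exact_mod_cast h) (by exact_mod_cast hn)
  have hF : ∀ n : ℕ, ‖χ (n : ZMod g) * expChar (α * (A * n))‖ ≤ 1 := fun n => by
    rw [norm_mul, norm_expChar, mul_one]
    exact χ.norm_le_one _
  have hΛ : ∀ n ≤ N, ‖(ArithmeticFunction.vonMangoldt n : ℂ)
      * (χ (n : ZMod g) * expChar (α * (A * n)))‖ ≤ Real.log N := fun n hn => by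
    rw [norm_mul, Complex.norm_real, Real.norm_eq_abs,
      abs_of_nonneg ArithmeticFunction.vonMangoldt_nonneg]
    exact (mul_le_of_le_one_right ArithmeticFunction.vonMangoldt_nonneg (hF n)).trans
      (ArithmeticFunction.vonMangoldt_le_log.trans (hlog n hn))
  have hXL : minorArcFactor N q * Real.log N ≤ 4 * minorArcFactor N q * Real.log N ^ 3 := by
    have h1 : 1 ≤ (2 * Real.log N) ^ 2 := one_le_pow₀ hL2
    have h2 : 0 ≤ minorArcFactor N q * Real.log N := by positivity
    nlinarith [mul_le_mul_of_nonneg_left h1 h2]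
  have hXL2 : minorArcFactor N q * Real.log N ^ 2 ≤ 2 * minorArcFactor N q * Real.log N ^ 3 := by
    have h2 : 0 ≤ minorArcFactor N q * Real.log N ^ 2 := by positivity
    nlinarith [mul_le_mul_of_nonneg_left hL2 h2]
  have hXL3 : 0 ≤ minorArcFactor N q * Real.log N ^ 3 := by positivity
  have hgA : (0 : ℝ) ≤ g * (A * g) ^ 2 := by positivity
  rcases Nat.lt_or_ge N q with hNq | hqN
  · calc _ ≤ ∑ _n ∈ Finset.Ico 1 (N + 1), Real.log N := norm_sum_le_of_le _ fun n hn =>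
          hΛ n (Nat.lt_succ_iff.mp (Finset.mem_Ico.mp hn).2)
      _ = N * Real.log N := by simp
      _ ≤ minorArcFactor N q * Real.log N := by
          gcongr
          exact le_minorArcFactor_of_le hNpos hq (by exact_mod_cast hNq.le)
      _ ≤ _ := hXL
      _ ≤ _ := by
          have h1 := mul_nonneg hgA hXL3
          have h2 : 0 ≤ A * (minorArcFactor N q * Real.log N ^ 3) := by positivity
          linarith
  set U : ℕ := ⌊(N : ℝ) ^ ((2 : ℝ) / 5)⌋₊ with hU
  have hU1 : (N : ℝ) ^ ((2 : ℝ) / 5) < U + 1 := Nat.lt_floor_add_one _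
  have hU2 : (U : ℝ) ≤ (N : ℝ) ^ ((2 : ℝ) / 5) := Nat.floor_le (by positivity)
  have hUU : ((U * U : ℕ) : ℝ) ≤ (N : ℝ) ^ ((4 : ℝ) / 5) := by
    have h1 : (N : ℝ) ^ ((4 : ℝ) / 5) = (N : ℝ) ^ ((2 : ℝ) / 5) * (N : ℝ) ^ ((2 : ℝ) / 5) := by
      rw [← Real.rpow_add hNpos]
      norm_num
    rw [h1]
    push_cast
    gcongr
  have hU4 : (U : ℝ) ≤ (N : ℝ) ^ ((4 : ℝ) / 5) :=
    le_trans (by exact_mod_cast Nat.le_mul_self U) hUU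
  obtain ⟨Φ, hΦ0, hΦ, hΦsum⟩ := exists_twisted_sum_majorant hq hgcd hα hA hg χ N
  have hI := fun D hD => (hΦsum D).trans (typeI_majorant_le hq hqN hN hA hg hD)
  set Λ₁ := ArithmeticFunction.vonMangoldt.truncLE U with hΛ₁
  set μ₁ := (ArithmeticFunction.moebius : ArithmeticFunction ℝ).truncLE U with hμ₁
  have hμ₁1 : ∀ n, |μ₁ n| ≤ 1 := fun n =>
    (ArithmeticFunction.abs_truncLE_le _ _ _).trans (abs_moebius_coe_le_one n)
  have hμ₁U : ∀ n, U < n → μ₁ n = 0 := fun n hn => by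
    rw [hμ₁, ArithmeticFunction.truncLE_apply, if_neg (by lia)]
  have hΛ₁U : ∀ n, U < n → Λ₁ n = 0 := fun n hn => by
    rw [hΛ₁, ArithmeticFunction.truncLE_apply, if_neg (by lia)]
  have hζ : ∀ n, |(ArithmeticFunction.zeta : ArithmeticFunction ℝ) n| ≤ 1 := fun n => by
    rw [ArithmeticFunction.natCoe_apply, ArithmeticFunction.zeta_apply]
    split_ifs <;> simp
  have habsΛ : ∀ n, |ArithmeticFunction.vonMangoldt n| = ArithmeticFunction.vonMangoldt n :=
    fun n => abs_of_nonneg ArithmeticFunction.vonMangoldt_nonneg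
  -- the initial segment
  have hS1 : ‖∑ n ∈ Finset.Ico 1 (N + 1), (Λ₁ n : ℂ)
      * (χ (n : ZMod g) * expChar (α * (A * n)))‖ ≤ minorArcFactor N q * Real.log N := by
    calc _ ≤ ∑ n ∈ Finset.Ico 1 (N + 1), if n ∈ Finset.Ico 1 (U + 1) then Real.log N else 0 := by
          refine norm_sum_le_of_le _ fun n hn => ?_
          have hn' := Finset.mem_Ico.mp hn
          split_ifs with hnU
          · rw [hΛ₁, ArithmeticFunction.truncLE_apply,
              if_pos (Nat.lt_succ_iff.mp (Finset.mem_Ico.mp hnU).2)]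
            exact hΛ n (by lia)
          · rw [hΛ₁U n (by simp only [Finset.mem_Ico] at hnU; lia)]
            simp
      _ = ∑ n ∈ Finset.Ico 1 (N + 1) with n ∈ Finset.Ico 1 (U + 1), Real.log N :=
          (Finset.sum_filter _ _).symm
      _ ≤ ∑ n ∈ Finset.Ico 1 (U + 1), Real.log N := Finset.sum_le_sum_of_subset_of_nonneg
          (fun d hd => (Finset.mem_filter.mp hd).2) fun _ _ _ => hL0
      _ = U * Real.log N := by simp
      _ ≤ _ := by
          gcongr
          exact hU4.trans (rpow_le_minorArcFactor hNpos.le q)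
  -- the type I sums
  have hS2 : ‖∑ n ∈ Finset.Ico 1 (N + 1), ((μ₁ * ArithmeticFunction.log) n : ℂ)
      * (χ (n : ZMod g) * expChar (α * (A * n)))‖
      ≤ 1 * (2 * Real.log N * (88 * g * (A * g) ^ 2 * (minorArcFactor N q * Real.log N))) := by
    refine (norm_sum_convolution_twist_le zero_le_one (by positivity : 0 ≤ 2 * Real.log N) hΦ0
      (fun d _ => hμ₁1 d) hμ₁U fun d hd hdN => ?_).trans ?_
    · simp only [ArithmeticFunction.log_apply]
      refine (norm_sum_log_mul_le (Nat.div_pos hdN hd) (hΦ d hd)).trans ?_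
      exact mul_le_mul_of_nonneg_right
        (mul_le_mul_of_nonneg_left (hlog _ (Nat.div_le_self N d)) zero_le_two) (hΦ0 d)
    · exact mul_le_mul_of_nonneg_left
        (mul_le_mul_of_nonneg_left (hI U hU4) (by positivity)) zero_le_one
  have hS3 : ‖∑ n ∈ Finset.Ico 1 (N + 1), ((μ₁ * Λ₁ * ArithmeticFunction.zeta) n : ℂ)
      * (χ (n : ZMod g) * expChar (α * (A * n)))‖
      ≤ Real.log N * (1 * (88 * g * (A * g) ^ 2 * (minorArcFactor N q * Real.log N))) := by
    refine (norm_sum_convolution_twist_le hL0 zero_le_one hΦ0 (fun d hd =>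
      (ArithmeticFunction.abs_mul_apply_le_log hμ₁1 (fun n => ?_) d).trans (hlog d hd))
      (fun d hd => ArithmeticFunction.mul_apply_eq_zero_of_lt hμ₁U hΛ₁U hd)
      fun d hd hdN => ?_).trans ?_
    · exact (ArithmeticFunction.abs_truncLE_le _ _ _).trans (habsΛ n).le
    · rw [one_mul]
      refine le_trans (le_of_eq (congrArg _ (Finset.sum_congr rfl fun m hm => ?_)))
        (hΦ d hd _ le_rfl)
      have hm0 : m ≠ 0 := by have := (Finset.mem_Ico.mp hm).1; lia
      rw [ArithmeticFunction.natCoe_apply, ArithmeticFunction.zeta_apply_ne hm0]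
      simp
    · exact mul_le_mul_of_nonneg_left
        (mul_le_mul_of_nonneg_left (hI (U * U) hUU) zero_le_one) hL0
  -- the type II sum
  have hS4 : ‖∑ n ∈ Finset.Ico 1 (N + 1),
      ((((ArithmeticFunction.moebius : ArithmeticFunction ℝ) - μ₁)
        * (ArithmeticFunction.zeta * (ArithmeticFunction.vonMangoldt - Λ₁))) n : ℂ)
      * (χ (n : ZMod g) * expChar (α * (A * n)))‖
      ≤ 240 * A * minorArcFactor N q * Real.log N ^ 3 := by
    rw [ArithmeticFunction.sum_mul_apply_mul_twist]
    refine norm_bilinear_hyperbola_le hq hgcd hα hA hN hqN hU1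
      (b := fun d => (((ArithmeticFunction.moebius : ArithmeticFunction ℝ) - μ₁) d : ℂ)
        * χ (d : ZMod g))
      (c := fun l => ((ArithmeticFunction.zeta * (ArithmeticFunction.vonMangoldt - Λ₁)) l : ℂ)
        * χ (l : ZMod g)) (fun d => ?_) (fun d hd => ?_) (fun l hl => ?_) (fun l hl => ?_)
    · rw [norm_mul, Complex.norm_real, Real.norm_eq_abs]
      exact mul_le_one₀ ((ArithmeticFunction.abs_sub_truncLE_le _ _ _).trans
        (abs_moebius_coe_le_one d)) (norm_nonneg _) (χ.norm_le_one _)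
    · rw [hμ₁, ArithmeticFunction.sub_truncLE_apply, if_pos hd]
      simp
    · rw [norm_mul, Complex.norm_real, Real.norm_eq_abs]
      refine (mul_le_of_le_one_right (abs_nonneg _) (χ.norm_le_one _)).trans
        ((ArithmeticFunction.abs_mul_apply_le_log hζ (fun n => ?_) l).trans (hlog l hl))
      exact (ArithmeticFunction.abs_sub_truncLE_le _ _ _).trans (habsΛ n).le
    · rw [ArithmeticFunction.mul_apply_eq_zero_of_le (U := U) (fun n hn => ?_) hl]
      · simp
      · rw [hΛ₁, ArithmeticFunction.sub_truncLE_apply, if_pos hn]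
  have hsplit : ∑ n ∈ Finset.Ico 1 (N + 1), (ArithmeticFunction.vonMangoldt n : ℂ)
        * (χ (n : ZMod g) * expChar (α * (A * n)))
      = ∑ n ∈ Finset.Ico 1 (N + 1), (Λ₁ n : ℂ) * (χ (n : ZMod g) * expChar (α * (A * n)))
      + ∑ n ∈ Finset.Ico 1 (N + 1), ((μ₁ * ArithmeticFunction.log) n : ℂ)
        * (χ (n : ZMod g) * expChar (α * (A * n)))
      - ∑ n ∈ Finset.Ico 1 (N + 1), ((μ₁ * Λ₁ * ArithmeticFunction.zeta) n : ℂ)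
        * (χ (n : ZMod g) * expChar (α * (A * n)))
      + ∑ n ∈ Finset.Ico 1 (N + 1),
        ((((ArithmeticFunction.moebius : ArithmeticFunction ℝ) - μ₁)
          * (ArithmeticFunction.zeta * (ArithmeticFunction.vonMangoldt - Λ₁))) n : ℂ)
        * (χ (n : ZMod g) * expChar (α * (A * n))) := by
    rw [← Finset.sum_add_distrib, ← Finset.sum_sub_distrib, ← Finset.sum_add_distrib]
    refine Finset.sum_congr rfl fun n _ => ?_
    have h := congrArg (fun f : ArithmeticFunction ℝ => ((f n : ℝ) : ℂ))
      (ArithmeticFunction.vonMangoldt_eq_vaughan U)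
    rw [← add_mul, ← sub_mul, ← add_mul]
    refine congrArg (· * _) (h.trans ?_)
    rw [← hΛ₁, ← hμ₁]
    norm_cast
  rw [hsplit]
  refine (norm_add_le _ _).trans ((add_le_add ((norm_sub_le _ _).trans (add_le_add
    ((norm_add_le _ _).trans (add_le_add hS1 hS2)) hS3)) hS4).trans ?_)
  have h1 := mul_le_mul_of_nonneg_left hXL2 hgA
  linarith

open ArithmeticFunction in
/-- Vaughan-type bound for the twisted von Mangoldt exponential sum:
if `α` admits a rational approximation `a/q` with `gcd(a,q)=1` and `|α - a/q| ≤ 1/q²`, then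
`|∑_{n ≤ x} χ(n) Λ(n) e(αAn)| ≤ C (x^{4/5} + x q^{-1/2} + x^{1/2} q^{1/2}) (log x)³`. -/
theorem vonMangoldt_twisted_exponential_sum_bound
    (A g : ℕ) (hA : 0 < A) (hg : 0 < g) :
    ∃ C : ℝ, ∀ (χ : DirichletCharacter ℂ g),
      ∀ (α : ℝ) (q : ℕ), 1 ≤ q →
        (∃ a : ℤ, Int.gcd a q = 1 ∧ |α - (a : ℝ) / q| ≤ 1 / (q : ℝ) ^ 2) →
        ∀ x : ℝ, 2 ≤ x →
          ‖∑ n ∈ Finset.Icc 1 ⌊x⌋₊,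
              χ (n : ZMod g) * (Λ n : ℂ) *
                Complex.exp (2 * Real.pi * Complex.I * (α * (A * n)))‖
            ≤ C * (x ^ ((4 : ℝ) / 5) + x * (q : ℝ) ^ (-(1 : ℝ) / 2)
                + x ^ ((1 : ℝ) / 2) * (q : ℝ) ^ ((1 : ℝ) / 2)) * Real.log x ^ 3 := by
  refine ⟨4 + 528 * g * (A * g) ^ 2 + 240 * A, fun χ α q hq ⟨a, hgcd, hα⟩ x hx => ?_⟩
  have hN : 2 ≤ ⌊x⌋₊ := Nat.le_floor (by exact_mod_cast hx)
  have hNx : (⌊x⌋₊ : ℝ) ≤ x := Nat.floor_le (by linarith)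
  have hN1 : (1 : ℝ) ≤ ⌊x⌋₊ := by exact_mod_cast (by lia : 1 ≤ ⌊x⌋₊)
  have hmain := norm_sum_vonMangoldt_twist_le hq hgcd hα hA hg χ hN
  have hsum : ∑ n ∈ Finset.Icc 1 ⌊x⌋₊, χ (n : ZMod g) * (Λ n : ℂ) *
        Complex.exp (2 * Real.pi * Complex.I * (α * (A * n)))
      = ∑ n ∈ Finset.Ico 1 (⌊x⌋₊ + 1), (Λ n : ℂ)
        * (χ (n : ZMod g) * expChar (α * (A * n))) := by
    refine Finset.sum_congr (by ext; simp) fun n _ => ?_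
    rw [expChar]
    push_cast
    ring
  rw [hsum]
  refine hmain.trans ?_
  have hmono := minorArcFactor_mono (zero_le_one.trans hN1) hNx q
  have hX0 := minorArcFactor_nonneg (zero_le_one.trans hN1) q
  have hlog := Real.log_le_log (by linarith) hNx
  have hlog0 := Real.log_nonneg hN1
  change _ ≤ _ * minorArcFactor x q * _
  gcongr
  exact mul_nonneg (by positivity) (hX0.trans hmono)
end

section
/- Let A, B, g be positive integers, i, j integers, β a real number with 0 < β < 1, and n, P positive integers with n > 2P. Then ∑_{P < k < n − P, B | (n − Ak), k ≡ i (mod g), (n−Ak)/B ≡ j (mod g)} (k·(n − Ak)/B)^{β − 1} ≤ n^{β}, where the sum is over integers k in (P, n − P) with n − Ak positive and divisible by B and the indicated congruence conditions. -/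
attribute [local instance] Classical.propDecidable

/-- If `f` is positive and strictly decreasing on a finite set `S` of positive integers, then
`k * f k` is at least the cardinality of `S` for every `k ∈ S`. -/
theorem card_le_mul_of_strictAntiOn {S : Finset ℤ} {f : ℤ → ℤ} (hS : ∀ k ∈ S, 0 < k)
    (hf : ∀ k ∈ S, 0 < f k) (hanti : StrictAntiOn f S) {k : ℤ} (hk : k ∈ S) :
    (S.card : ℤ) ≤ k * f k := by
  have hlow : (S.filter (· ≤ k)).card ≤ (Finset.Ioc 0 k).card := by
    refine Finset.card_le_card fun l hl => ?_
    rw [Finset.mem_filter] at hl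
    exact Finset.mem_Ioc.2 ⟨hS l hl.1, hl.2⟩
  have hhigh : (S.filter (¬ · ≤ k)).card ≤ (Finset.Ioo 0 (f k)).card := by
    refine Finset.card_le_card_of_injOn f (fun l hl => ?_) (hanti.injOn.mono fun l hl => ?_)
    · rw [Finset.mem_coe, Finset.mem_filter, not_le] at hl
      exact Finset.mem_coe.2 (Finset.mem_Ioo.2 ⟨hf l hl.1, hanti hk hl.1 hl.2⟩)
    · exact (Finset.mem_filter.1 hl).1
  have hsplit := Finset.card_filter_add_card_filter_not (s := S) (· ≤ k)
  have hk0 := hS k hk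
  have hfk := hf k hk
  rw [Int.card_Ioc] at hlow
  rw [Int.card_Ioo] at hhigh
  have hcard : (S.card : ℤ) ≤ k + (f k - 1) := by omega
  nlinarith

/-- If `f` is positive and strictly decreasing on a finite set `S` of positive integers, then
`∑ k ∈ S, (k * f k) ^ (β - 1) ≤ #S ^ β` for `0 < β ≤ 1`. -/
theorem sum_rpow_le_card_rpow_of_strictAntiOn {S : Finset ℤ} {f : ℤ → ℤ}
    (hS : ∀ k ∈ S, 0 < k) (hf : ∀ k ∈ S, 0 < f k) (hanti : StrictAntiOn f S)
    {β : ℝ} (hβ0 : 0 < β) (hβ1 : β ≤ 1) :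
    ∑ k ∈ S, ((k * f k : ℤ) : ℝ) ^ (β - 1) ≤ (S.card : ℝ) ^ β := by
  rcases S.eq_empty_or_nonempty with rfl | hne
  · simp [Real.zero_rpow hβ0.ne']
  have hpos : (0 : ℝ) < S.card := by exact_mod_cast hne.card_pos
  calc ∑ k ∈ S, ((k * f k : ℤ) : ℝ) ^ (β - 1)
      ≤ ∑ _k ∈ S, (S.card : ℝ) ^ (β - 1) := by
        refine Finset.sum_le_sum fun k hk => ?_
        refine Real.rpow_le_rpow_of_nonpos hpos ?_ (by linarith)
        exact_mod_cast card_le_mul_of_strictAntiOn hS hf hanti hk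
    _ = (S.card : ℝ) ^ β := by
        rw [Finset.sum_const, nsmul_eq_mul, Real.rpow_sub_one hpos.ne', mul_div_cancel₀ _ hpos.ne']

/-- Bound for the exceptional-character sum:
`∑_{P < k < n-P, B ∣ n-Ak, k ≡ i, (n-Ak)/B ≡ j (mod g)} (k(n-Ak)/B)^{β-1} ≤ n^β`
for `0 < β < 1`. -/
theorem exceptional_sum_bound
    (A B g : ℕ) (hA : 0 < A) (hB : 0 < B) (hg : 0 < g) (i j : ℤ)
    (β : ℝ) (hβ0 : 0 < β) (hβ1 : β < 1)
    (n P : ℕ) (hn : 0 < n) (hP : 0 < P) (hnP : 2 * P < n) :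
    ∑ k ∈ (Finset.Ioo (P : ℤ) ((n : ℤ) - P)).filter
        (fun k : ℤ => 0 < (n : ℤ) - A * k ∧ (B : ℤ) ∣ ((n : ℤ) - A * k) ∧
          k ≡ i [ZMOD (g : ℤ)] ∧ ((n : ℤ) - A * k) / B ≡ j [ZMOD (g : ℤ)]),
      ((k * (((n : ℤ) - A * k) / B) : ℤ) : ℝ) ^ (β - 1)
      ≤ (n : ℝ) ^ β := by
  have hB' : (0 : ℤ) < B := by exact_mod_cast hB
  have hA' : (0 : ℤ) < A := by exact_mod_cast hA
  refine (sum_rpow_le_card_rpow_of_strictAntiOn (f := fun k => ((n : ℤ) - A * k) / B)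
    (fun k hk => ?_) (fun k hk => ?_) (fun k hk l hl hkl => ?_) hβ0 hβ1.le).trans ?_
  · have := (Finset.mem_Ioo.1 (Finset.mem_filter.1 hk).1).1
    omega
  · obtain ⟨-, hpos, hdvd, -⟩ := Finset.mem_filter.1 hk
    exact Int.ediv_pos_of_pos_of_dvd hpos hB'.le hdvd
  · obtain ⟨-, -, hdvd, -⟩ := Finset.mem_filter.1 (Finset.mem_coe.1 hk)
    obtain ⟨-, -, hdvd_l, -⟩ := Finset.mem_filter.1 (Finset.mem_coe.1 hl)
    refine Int.lt_of_mul_lt_mul_right (a := (B : ℤ)) ?_ hB'.le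
    rw [Int.ediv_mul_cancel hdvd, Int.ediv_mul_cancel hdvd_l]
    nlinarith
  · refine Real.rpow_le_rpow (Nat.cast_nonneg _) ?_ hβ0.le
    have hcard := Finset.card_filter_le (Finset.Ioo (P : ℤ) ((n : ℤ) - P))
        (fun k : ℤ => 0 < (n : ℤ) - A * k ∧ (B : ℤ) ∣ ((n : ℤ) - A * k) ∧
          k ≡ i [ZMOD (g : ℤ)] ∧ ((n : ℤ) - A * k) / B ≡ j [ZMOD (g : ℤ)])
    rw [Int.card_Ioo] at hcard
    exact_mod_cast hcard.trans (by omega)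
end

section
/- Let g be a prime and q a positive integer divisible by g. Let χ be a primitive Dirichlet character of modulus q and χ' a Dirichlet character of modulus g. Then the conductor of the product character χ·χ' (of modulus q) equals q, except in the case where g exactly divides q (i.e., v_g(q) = 1) and the g-part of χ in the decomposition of χ along the prime power factors of q is the inverse of χ', in which case the conductor of χ·χ' equals q/g. -/
namespace DirichletCharacter

/-- A product `χ * ψ`, with `χ` of level `n` and `ψ` of level `m ∣ n`, factors through `d ∣ n` iff
it is trivial on the units congruent to `1` modulo `d`. -/
lemma mul_changeLevel_factorsThrough_iff {R : Type*} [CommMonoidWithZero R] {n m d : ℕ} [NeZero n]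
    (hm : m ∣ n) (hd : d ∣ n) (χ : DirichletCharacter R n) (ψ : DirichletCharacter R m) :
    (χ * changeLevel hm ψ).FactorsThrough d ↔
      ∀ u : (ZMod n)ˣ, ZMod.castHom hd (ZMod d) (u : ZMod n) = 1 →
        χ (u : ZMod n) * ψ (ZMod.castHom hm (ZMod m) (u : ZMod n)) = 1 := by
  rw [factorsThrough_iff_ker_unitsMap hd]
  refine forall_congr' fun u ↦ ?_
  rw [MonoidHom.mem_ker, MonoidHom.mem_ker, Units.ext_iff, Units.ext_iff, MulChar.coe_toUnitHom,
    MulChar.mul_apply, changeLevel_eq_cast_of_dvd, ZMod.unitsMap_val]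
  rfl

/-- The level of a primitive character divides the least common multiple of the conductor of
any twist and the level of the twisting character. -/
lemma IsPrimitive.dvd_lcm_conductor_mul_changeLevel {R : Type*} [CommRing R] {n m : ℕ} [NeZero n]
    (hm : m ∣ n) {χ : DirichletCharacter R n} (hχ : χ.IsPrimitive) (ψ : DirichletCharacter R m) :
    n ∣ (χ * changeLevel hm ψ).conductor.lcm m := by
  have h := conductor_mul_dvd_lcm_conductor (χ * changeLevel hm ψ) (changeLevel hm ψ)⁻¹
  rw [mul_inv_cancel_right, hχ, conductor_inv, conductor_changeLevel] at h
  exact h.trans (Nat.lcm_dvd_lcm_of_dvd_right _ ψ.conductor_dvd_level)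

end DirichletCharacter

/-- If `c ∣ q ∣ lcm c g` with `g` prime dividing `q`, then `c = q`, unless `c = q / g` is prime
to `g`. -/
lemma Nat.Prime.eq_or_eq_div_of_dvd_lcm {g q c : ℕ} (hg : g.Prime) (hgq : g ∣ q) (hcq : c ∣ q)
    (hq : q ∣ c.lcm g) : c = q ∨ (¬ g ∣ q / g ∧ c = q / g) := by
  by_cases hgc : g ∣ c
  · exact .inl (hcq.antisymm (hq.trans (Nat.lcm_dvd dvd_rfl hgc)))
  · have hcop : c.Coprime g := ((hg.coprime_iff_not_dvd).2 hgc).symm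
    have h : q = c * g := by
      rw [hcop.lcm_eq_mul] at hq
      exact hq.antisymm (hcop.mul_dvd_of_dvd_of_dvd hcq hgq)
    have hc : c = q / g := by rw [h, Nat.mul_div_cancel _ hg.pos]
    exact .inr ⟨hc ▸ hgc, hc⟩

/-- For `g` prime, `g ∣ q`, `χ` primitive mod `q` and `χ'` mod `g`,
the conductor of `χ·χ'` (of modulus `q`) equals `q`, except when `v_g(q) = 1` and the
`g`-part of `χ` is the inverse of `χ'` (i.e. `χ(u)·χ'(u mod g) = 1` for every unit
`u ≡ 1 (mod q/g)`), in which case it equals `q/g`. -/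
theorem conductor_mul_changeLevel
    (g q : ℕ) (hgp : g.Prime) (hq : 0 < q) (hgq : g ∣ q)
    (χ : DirichletCharacter ℂ q) (hχ : χ.IsPrimitive)
    (χ' : DirichletCharacter ℂ g) :
    ((¬ ((¬ g ∣ q / g) ∧
        ∀ u : (ZMod q)ˣ,
          ZMod.castHom (Nat.div_dvd_of_dvd hgq) (ZMod (q / g)) (u : ZMod q) = 1 →
            χ (u : ZMod q) * χ' (ZMod.castHom hgq (ZMod g) (u : ZMod q)) = 1)) →
      (χ * DirichletCharacter.changeLevel hgq χ').conductor = q) ∧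
    (((¬ g ∣ q / g) ∧
        ∀ u : (ZMod q)ˣ,
          ZMod.castHom (Nat.div_dvd_of_dvd hgq) (ZMod (q / g)) (u : ZMod q) = 1 →
            χ (u : ZMod q) * χ' (ZMod.castHom hgq (ZMod g) (u : ZMod q)) = 1) →
      (χ * DirichletCharacter.changeLevel hgq χ').conductor = q / g) := by
  have : NeZero q := ⟨hq.ne'⟩
  rw [← DirichletCharacter.mul_changeLevel_factorsThrough_iff]
  have hc := hgp.eq_or_eq_div_of_dvd_lcm hgq
    (χ * DirichletCharacter.changeLevel hgq χ').conductor_dvd_level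
    (hχ.dvd_lcm_conductor_mul_changeLevel hgq χ')
  refine ⟨fun h ↦ hc.resolve_right fun ⟨hg, hcg⟩ ↦ h ⟨hg, ?_⟩, fun ⟨_, h⟩ ↦ ?_⟩
  · exact hcg ▸ DirichletCharacter.factorsThrough_conductor _
  · refine (hc.resolve_left fun hcq ↦ ?_).2
    have hle := Nat.sInf_le ((DirichletCharacter.mem_conductorSet_iff _).2 h)
    exact (Nat.div_lt_self hq hgp.one_lt).not_ge (hcq.symm.le.trans hle)
end
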